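/- (Quantitative OGP.) Let λ > 0 and k, k', n ∈ ℕ with k, k' ≤ n, k, k', n → ∞ and k, k' = o(n), and suppose Assumptions (λ) and (k') hold. Then there exist constants C₀ > 1, D₀ > 0 and a sequence of integers ℓ = ℓ_n such that: (i) ℓ = ω(kk'/n), ℓ = o(min{k, k'}), ℓ = O( (k/λ)·√( (k'/n)·log(n/k') ) ), and ℓ = ω(√(k')); and (ii) with high probability over W ∼ GOE(n), min over integers ℓ' ∈ (ℓ/3, ℓ/2) of φ_{k'}(ℓ') ≥ max{ φ_{k'}(⌊k'k/n⌋), φ_{k'}(C₀·ℓ) } + D₀·(k'k)/(λn). In particular, the optimization problem Φ_{k'} exhibits the k'-Overlap Gap Property with ζ₂ − ζ₁ = Θ(ℓ) = ω(√(k')), with high probability as n → ∞. -/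

import Mathlib

open MeasureTheory ProbabilityTheory Filter Asymptotics

noncomputable def goeMeasure (n : ℕ) : Measure (Fin n → Fin n → ℝ) :=
  Measure.map (fun g i j => g (min i j, max i j))
    (Measure.pi fun p : Fin n × Fin n =>
      gaussianReal 0 (if p.1 = p.2 then 2 / (n : NNReal) else 1 / (n : NNReal)))

noncomputable def quadForm {n : ℕ} (Y : Fin n → Fin n → ℝ) (S : Finset (Fin n)) : ℝ :=
  ∑ i ∈ S, ∑ j ∈ S, Y i j

noncomputable def Ymat {n : ℕ} (k : ℕ) (lam : ℝ) (x : Finset (Fin n))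
    (W : Fin n → Fin n → ℝ) : Fin n → Fin n → ℝ :=
  fun i j => lam / k * ((if i ∈ x then (1 : ℝ) else 0) * (if j ∈ x then (1 : ℝ) else 0)) + W i j

open Classical in
noncomputable def regionSum {n : ℕ} (k' : ℕ) (β : ℝ) (Y : Fin n → Fin n → ℝ)
    (P : Finset (Fin n) → Prop) : ℝ :=
  ∑ S ∈ Finset.univ.filter (fun S : Finset (Fin n) => S.card = k' ∧ P S),
    Real.exp (β * quadForm Y S)

noncomputable def gibbsProb {n : ℕ} (k' : ℕ) (β : ℝ) (Y : Fin n → Fin n → ℝ)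
    (P : Finset (Fin n) → Prop) : ℝ :=
  regionSum k' β Y P / regionSum k' β Y fun _ => True

noncomputable def FEWdepthY {n : ℕ} (k' : ℕ) (β ℓ : ℝ) (x : Finset (Fin n))
    (Y : Fin n → Fin n → ℝ) : ℝ :=
  Real.log (gibbsProb k' β Y fun S => ((x ∩ S).card : ℝ) < ℓ) -
    Real.log (gibbsProb k' β Y fun S => ℓ ≤ ((x ∩ S).card : ℝ) ∧ ((x ∩ S).card : ℝ) ≤ 2 * ℓ)

noncomputable def FEWdepth {n : ℕ} (k k' : ℕ) (lam β ℓ : ℝ) (x : Finset (Fin n))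
    (W : Fin n → Fin n → ℝ) : ℝ :=
  FEWdepthY k' β ℓ x (Ymat k lam x W)

noncomputable def phiVal {n : ℕ} (k' ℓ : ℕ) (Y : Fin n → Fin n → ℝ) (x : Finset (Fin n)) : ℝ :=
  sInf {r : ℝ | ∃ S : Finset (Fin n), S.card = k' ∧ (x ∩ S).card = ℓ ∧ r = -quadForm Y S}

noncomputable def gammaCurve (n k k' : ℕ) (lam : ℝ) (ℓ : ℕ) : ℝ :=
  -(lam * (ℓ : ℝ) ^ 2 / k) -
    2 * k' * Real.sqrt (1 / (n : ℝ) *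
      Real.log ((k.choose ℓ : ℝ) * ((n - k).choose (k' - ℓ) : ℝ)))

noncomputable def ellCrit (n k k' : ℕ) (lam : ℝ) : ℝ :=
  1 / (2 * lam) * k * Real.sqrt ((k' : ℝ) / ((n : ℝ) * Real.log ((n : ℝ) / (k' : ℝ)))) *
    Real.log (1 / (2 * lam) * Real.sqrt ((n : ℝ) / ((k' : ℝ) * Real.log ((n : ℝ) / (k' : ℝ)))))

def AssumLambda (k : ℕ → ℕ) (lam : ℕ → ℝ) : Prop :=
  ((fun n => (k n : ℝ) / n * Real.log ((n : ℝ) / (k n : ℝ))) =o[atTop] lam) ∧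
    (lam =o[atTop] fun n => min 1 ((k n : ℝ) / (Real.sqrt n * Real.log n)))

def AssumKprime (k k' : ℕ → ℕ) (lam : ℕ → ℝ) : Prop :=
  ((fun n => (k n : ℝ) ^ 2 / (lam n ^ 2 * n) * (Real.log ((n : ℝ) / (k n : ℝ))) ^ 2 /
      Real.log (lam n * n / (k n * Real.log ((n : ℝ) / (k n : ℝ))))) =o[atTop]
    fun n => (k' n : ℝ)) ∧
  ((fun n => (k' n : ℝ)) =o[atTop] fun n => lam n ^ 2 * n / Real.log n ^ 3) ∧
  ((fun n => (k' n : ℝ)) =o[atTop]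
    fun n => ((k n : ℝ) ^ 2 * n / (lam n ^ 2 * Real.log n)) ^ ((1 : ℝ) / 3))

def hasOGP {n : ℕ} (k k' : ℕ) (Y : Fin n → Fin n → ℝ) (x : Finset (Fin n)) (ζ₁ ζ₂ : ℕ) : Prop :=
  ζ₁ ≤ min k k' ∧ ζ₂ ≤ min k k' ∧ ζ₁ + 2 < ζ₂ ∧
    ∃ r : ℝ,
      (∃ v w : Finset (Fin n), v.card = k' ∧ w.card = k' ∧
        (x ∩ v).card ≤ ζ₁ ∧ ζ₂ ≤ (x ∩ w).card ∧ -quadForm Y v ≤ r ∧ -quadForm Y w ≤ r) ∧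
      ∀ v : Finset (Fin n), v.card = k' → -quadForm Y v ≤ r →
        (x ∩ v).card ≤ ζ₁ ∨ ζ₂ ≤ (x ∩ v).card

section part1

/-- One-dimensional Brunn-Minkowski inequality. -/
theorem bm_one {A B C : Set ℝ} (hA : MeasurableSet A) (hB : MeasurableSet B)
    (hAn : A.Nonempty) (hBn : B.Nonempty) {a b : ℝ} (ha : 0 < a) (hb : 0 < b)
    (hC : ∀ s ∈ A, ∀ t ∈ B, a * s + b * t ∈ C) :
    ENNReal.ofReal a * volume A + ENNReal.ofReal b * volume B ≤ volume C := by
  -- compact case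
  have key : ∀ K L : Set ℝ, IsCompact K → IsCompact L → K ⊆ A → L ⊆ B → K.Nonempty → L.Nonempty →
      ENNReal.ofReal a * volume K + ENNReal.ofReal b * volume L ≤ volume C := by
    intro K L hK hL hKA hLB hKn hLn
    obtain ⟨s, hsK, hs⟩ := hK.exists_isGreatest hKn
    obtain ⟨t, htL, ht⟩ := hL.exists_isLeast hLn
    set p := a * s + b * t with hp
    have h1 : (fun x => a⁻¹ * (x - b * t)) ⁻¹' K ⊆ C ∩ Set.Iic p := by
      intro x hx
      have hx' : a⁻¹ * (x - b * t) ∈ K := hx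
      refine ⟨?_, ?_⟩
      · have := hC _ (hKA hx') t (hLB htL)
        have e : a * (a⁻¹ * (x - b * t)) + b * t = x := by field_simp; ring
        rwa [e] at this
      · have := hs hx'
        have : a * (a⁻¹ * (x - b * t)) ≤ a * s := by gcongr
        have e : a * (a⁻¹ * (x - b * t)) = x - b * t := by field_simp
        simp only [Set.mem_Iic]; linarith
    have h2 : (fun x => b⁻¹ * (x - a * s)) ⁻¹' L \ {p} ⊆ C \ Set.Iic p := by
      rintro x ⟨hx, hxp⟩
      have hx' : b⁻¹ * (x - a * s) ∈ L := hx
      refine ⟨?_, ?_⟩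
      · have := hC s (hKA hsK) _ (hLB hx')
        have e : a * s + b * (b⁻¹ * (x - a * s)) = x := by field_simp; ring
        rwa [e] at this
      · have := ht hx'
        have : b * t ≤ b * (b⁻¹ * (x - a * s)) := by gcongr
        have e : b * (b⁻¹ * (x - a * s)) = x - a * s := by field_simp
        have hne : x ≠ p := hxp
        have : p ≤ x := by linarith
        simp only [Set.mem_Iic, not_le]
        exact lt_of_le_of_ne this hne.symm
    have vol : ∀ (c d : ℝ) (hc : 0 < c) (K : Set ℝ),
        volume ((fun x => c⁻¹ * (x - d)) ⁻¹' K) = ENNReal.ofReal c * volume K := by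
      intro c d hc K
      have : (fun x => c⁻¹ * (x - d)) ⁻¹' K
          = (fun x => x - d) ⁻¹' ((fun x => c⁻¹ * x) ⁻¹' K) := rfl
      simp only [sub_eq_add_neg] at this ⊢
      rw [this, measure_preimage_add_right, Real.volume_preimage_mul_left (by positivity)]
      simp [abs_of_pos hc]
    calc ENNReal.ofReal a * volume K + ENNReal.ofReal b * volume L
        ≤ volume (C ∩ Set.Iic p) + volume (C \ Set.Iic p) := by
          gcongr
          · rw [← vol a (b * t) ha]; exact measure_mono h1
          · rw [← vol b (a * s) hb, ← measure_sdiff_null (s := _) (t := {p}) (by simp)]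
            exact measure_mono h2
      _ = volume C := measure_inter_add_sdiff _ measurableSet_Iic
  obtain ⟨a0, ha0⟩ := hAn
  obtain ⟨b0, hb0⟩ := hBn
  have key2 : ∀ K L : Set ℝ, IsCompact K → IsCompact L → K ⊆ A → L ⊆ B →
      ENNReal.ofReal a * volume K + ENNReal.ofReal b * volume L ≤ volume C := by
    intro K L hK hL hKA hLB
    refine le_trans ?_ (key (insert a0 K) (insert b0 L) (hK.insert _) (hL.insert _)
      (Set.insert_subset ha0 hKA) (Set.insert_subset hb0 hLB) (Set.insert_nonempty _ _)
      (Set.insert_nonempty _ _))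
    gcongr <;> simp
  rw [hA.measure_eq_iSup_isCompact, hB.measure_eq_iSup_isCompact]
  simp only [ENNReal.mul_iSup]
  refine ENNReal.biSup_add_biSup_le' (ι := Set ℝ) (κ := Set ℝ) (p := fun K => K ⊆ A)
    (q := fun L => L ⊆ B) ⟨∅, Set.empty_subset _⟩ ⟨∅, Set.empty_subset _⟩ ?_
  intro K hK L hL
  by_cases hKc : IsCompact K
  · by_cases hLc : IsCompact L
    · simpa [hKc, hLc] using key2 K L hKc hLc hK hL
    · simpa [hKc, hLc] using key2 K ∅ hKc isCompact_empty hK (Set.empty_subset _)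
  · by_cases hLc : IsCompact L
    · simpa [hKc, hLc] using key2 ∅ L isCompact_empty hLc (Set.empty_subset _) hL
    · simp [hKc, hLc]

theorem pl_norm {f g h : ℝ → ℝ} (hf : Measurable f) (hg : Measurable g) (hh : Measurable h)
    (hf0 : ∀ s, 0 ≤ f s) (hg0 : ∀ s, 0 ≤ g s) (hh0 : ∀ s, 0 ≤ h s)
    (hf1 : ∀ s, f s ≤ 1) (hg1 : ∀ s, g s ≤ 1)
    (hfs : ∀ t < 1, ∃ s, t < f s) (hgs : ∀ t < 1, ∃ s, t < g s)
    {a b : ℝ} (ha : 0 < a) (hb : 0 < b)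
    (hc : ∀ s t, min (f s) (g t) ≤ h (a * s + b * t)) :
    ENNReal.ofReal a * (∫⁻ s, ENNReal.ofReal (f s)) +
      ENNReal.ofReal b * (∫⁻ s, ENNReal.ofReal (g s))
      ≤ ∫⁻ s, ENNReal.ofReal (h s) := by
  rw [lintegral_eq_lintegral_meas_lt _ (ae_of_all _ hf0) hf.aemeasurable,
    lintegral_eq_lintegral_meas_lt _ (ae_of_all _ hg0) hg.aemeasurable,
    lintegral_eq_lintegral_meas_lt _ (ae_of_all _ hh0) hh.aemeasurable]
  rw [← lintegral_const_mul' _ _ ENNReal.ofReal_ne_top,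
    ← lintegral_const_mul' _ _ ENNReal.ofReal_ne_top]
  refine le_trans (le_lintegral_add _ _) (lintegral_mono ?_)
  intro t
  by_cases ht : t < 1
  · refine bm_one (measurableSet_lt measurable_const hf) (measurableSet_lt measurable_const hg)
      (hfs t ht) (hgs t ht) ha hb ?_
    intro s hs r hr
    exact lt_of_lt_of_le (lt_min hs hr) (hc s r)
  · have e1 : {s | t < f s} = ∅ := by
      ext s; simp; linarith [hf1 s]
    have e2 : {s | t < g s} = ∅ := by
      ext s; simp; linarith [hg1 s]
    simp [e1, e2]

theorem ennreal_amgm (x y : ENNReal) {a b : ℝ} (ha : 0 < a) (hb : 0 < b) (hab : a + b = 1) :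
    x ^ a * y ^ b ≤ ENNReal.ofReal a * x + ENNReal.ofReal b * y := by
  by_cases hx : x = ⊤
  · have : ENNReal.ofReal a * x = ⊤ := by
      rw [hx, ENNReal.mul_top]; simpa using ha
    simp [this]
  by_cases hy : y = ⊤
  · have : ENNReal.ofReal b * y = ⊤ := by
      rw [hy, ENNReal.mul_top]; simpa using hb
    simp [this]
  lift x to NNReal using hx
  lift y to NNReal using hy
  have := Real.geom_mean_le_arith_mean2_weighted ha.le hb.le x.2 y.2 hab
  have e1 : (x : ENNReal) = ENNReal.ofReal (x : ℝ) := by simp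
  have e2 : (y : ENNReal) = ENNReal.ofReal (y : ℝ) := by simp
  rw [e1, e2, ENNReal.ofReal_rpow_of_nonneg (NNReal.coe_nonneg x) ha.le, ENNReal.ofReal_rpow_of_nonneg (NNReal.coe_nonneg y) hb.le,
    ← ENNReal.ofReal_mul (by positivity), ← ENNReal.ofReal_mul ha.le, ← ENNReal.ofReal_mul hb.le,
    ← ENNReal.ofReal_add (by positivity) (by positivity)]
  exact ENNReal.ofReal_le_ofReal this

theorem pl_one {f g h : ℝ → ℝ} (hf : Measurable f) (hg : Measurable g) (hh : Measurable h)
    (hf0 : ∀ s, 0 ≤ f s) (hg0 : ∀ s, 0 ≤ g s) (hh0 : ∀ s, 0 ≤ h s)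
    {M N : ℝ} (hf1 : ∀ s, f s ≤ M) (hg1 : ∀ s, g s ≤ N)
    {a b : ℝ} (ha : 0 < a) (hb : 0 < b) (hab : a + b = 1)
    (hc : ∀ s t, f s ^ a * g t ^ b ≤ h (a * s + b * t)) :
    (∫⁻ s, ENNReal.ofReal (f s)) ^ a * (∫⁻ s, ENNReal.ofReal (g s)) ^ b
      ≤ ∫⁻ s, ENNReal.ofReal (h s) := by
  have bf : BddAbove (Set.range f) := ⟨M, by rintro _ ⟨s, rfl⟩; exact hf1 s⟩
  have bg : BddAbove (Set.range g) := ⟨N, by rintro _ ⟨s, rfl⟩; exact hg1 s⟩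
  set F := ⨆ s, f s with hF
  set G := ⨆ s, g s with hG
  have hfF : ∀ s, f s ≤ F := fun s => le_ciSup bf s
  have hgG : ∀ s, g s ≤ G := fun s => le_ciSup bg s
  have hF0 : 0 ≤ F := (hf0 0).trans (hfF 0)
  have hG0 : 0 ≤ G := (hg0 0).trans (hgG 0)
  rcases hF0.eq_or_lt with hFz | hFp
  · have : ∀ s, f s = 0 := fun s => le_antisymm (hFz ▸ hfF s) (hf0 s)
    simp [this, ha]
  rcases hG0.eq_or_lt with hGz | hGp
  · have : ∀ s, g s = 0 := fun s => le_antisymm (hGz ▸ hgG s) (hg0 s)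
    simp [this, hb]
  set c := F ^ a * G ^ b with hcdef
  have hcp : 0 < c := by positivity
  have := pl_norm (f := fun s => F⁻¹ * f s) (g := fun s => G⁻¹ * g s) (h := fun s => c⁻¹ * h s)
    (hf.const_mul _) (hg.const_mul _) (hh.const_mul _)
    (fun s => mul_nonneg (by positivity) (hf0 s)) (fun s => mul_nonneg (by positivity) (hg0 s))
    (fun s => mul_nonneg (by positivity) (hh0 s))
    (fun s => by rw [inv_mul_le_iff₀ hFp]; simpa using hfF s)
    (fun s => by rw [inv_mul_le_iff₀ hGp]; simpa using hgG s)
    (fun t ht => by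
      have : t * F < ⨆ s, f s := by rw [← hF]; nlinarith
      obtain ⟨s, hs⟩ := exists_lt_of_lt_ciSup this
      exact ⟨s, by rw [lt_inv_mul_iff₀ hFp]; linarith⟩)
    (fun t ht => by
      have : t * G < ⨆ s, g s := by rw [← hG]; nlinarith
      obtain ⟨s, hs⟩ := exists_lt_of_lt_ciSup this
      exact ⟨s, by rw [lt_inv_mul_iff₀ hGp]; linarith⟩) ha hb
    (fun s t => by
      set u := F⁻¹ * f s
      set v := G⁻¹ * g t
      have hu : 0 ≤ u := mul_nonneg (by positivity) (hf0 s)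
      have hv : 0 ≤ v := mul_nonneg (by positivity) (hg0 t)
      have e : f s ^ a * g t ^ b = c * (u ^ a * v ^ b) := by
        have e1 : f s = F * u := by simp only [u]; field_simp
        have e2 : g t = G * v := by simp only [v]; field_simp
        rw [e1, e2, Real.mul_rpow hF0 hu, Real.mul_rpow hG0 hv, hcdef]; ring
      have h3 : c⁻¹ * (f s ^ a * g t ^ b) ≤ c⁻¹ * h (a * s + b * t) := by gcongr; exact hc s t
      rw [e, inv_mul_cancel_left₀ hcp.ne'] at h3
      refine le_trans ?_ h3
      have hm : 0 ≤ min u v := le_min hu hv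
      calc min u v = min u v ^ a * min u v ^ b := by
            rw [← Real.rpow_add_of_nonneg hm ha.le hb.le, hab, Real.rpow_one]
        _ ≤ u ^ a * v ^ b := by
            gcongr
            · exact min_le_left _ _
            · exact min_le_right _ _)
  have e : ∀ (c : ℝ) (hc : 0 < c) (f : ℝ → ℝ) (hf : Measurable f),
      ∫⁻ s, ENNReal.ofReal (c⁻¹ * f s) = ENNReal.ofReal c⁻¹ * ∫⁻ s, ENNReal.ofReal (f s) := by
    intro c hc f hf
    rw [← lintegral_const_mul _ (by fun_prop)]
    congr; ext s; rw [ENNReal.ofReal_mul (by positivity)]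
  rw [e _ hFp _ hf, e _ hGp _ hg, e _ hcp _ hh] at this
  have h4 := (ennreal_amgm _ _ ha hb hab).trans this
  rw [ENNReal.mul_rpow_of_nonneg _ _ ha.le, ENNReal.mul_rpow_of_nonneg _ _ hb.le,
    ENNReal.ofReal_rpow_of_pos (by positivity), ENNReal.ofReal_rpow_of_pos (by positivity),
    mul_mul_mul_comm, ← ENNReal.ofReal_mul (by positivity)] at h4
  have e5 : F⁻¹ ^ a * G⁻¹ ^ b = c⁻¹ := by
    rw [Real.inv_rpow hF0, Real.inv_rpow hG0, hcdef, mul_inv]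
  rw [e5] at h4
  have hne : ENNReal.ofReal c⁻¹ ≠ 0 := by simpa using hcp
  exact (ENNReal.mul_le_mul_iff_right hne ENNReal.ofReal_ne_top).1 h4

end part1

section part2

def PLprop (a b : ℝ) (ν : Measure ℝ) : Prop :=
  ∀ f g h : ℝ → ENNReal, Measurable f → Measurable g → Measurable h →
    (∀ s, f s ≤ 1) → (∀ s, g s ≤ 1) → (∀ s, h s ≤ 1) →
    (∀ s t, f s ^ a * g t ^ b ≤ h (a * s + b * t)) →
    (∫⁻ s, f s ∂ν) ^ a * (∫⁻ s, g s ∂ν) ^ b ≤ ∫⁻ s, h s ∂ν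

theorem pl_gaussian {v : NNReal} (hv : v ≠ 0) {a b : ℝ} (ha : 0 < a) (hb : 0 < b)
    (hab : a + b = 1) : PLprop a b (gaussianReal 0 v) := by
  intro f g h hf hg hh hf1 hg1 hh1 hc
  have conv : ∀ f : ℝ → ENNReal, Measurable f → (∀ s, f s ≤ 1) →
      ∫⁻ s, f s ∂(gaussianReal 0 v) =
        ∫⁻ s, ENNReal.ofReal (gaussianPDFReal 0 v s * (f s).toReal) := by
    intro f hf hf1
    rw [gaussianReal_of_var_ne_zero _ hv,
      lintegral_withDensity_eq_lintegral_mul _ (measurable_gaussianPDF 0 v) hf]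
    congr 1; ext s
    have hft : f s ≠ ⊤ := ne_top_of_le_ne_top ENNReal.one_ne_top (hf1 s)
    rw [ENNReal.ofReal_mul (gaussianPDFReal_nonneg _ _ _), ENNReal.ofReal_toReal hft]
    rfl
  rw [conv f hf hf1, conv g hg hg1, conv h hh hh1]
  have bd : ∀ f : ℝ → ENNReal, (∀ s, f s ≤ 1) → ∀ s,
      gaussianPDFReal 0 v s * (f s).toReal ≤ (Real.sqrt (2 * Real.pi * v))⁻¹ := by
    intro f hf1 s
    have h1 : (f s).toReal ≤ 1 := by
      have := ENNReal.toReal_mono ENNReal.one_ne_top (hf1 s); simpa using this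
    have h2 : gaussianPDFReal 0 v s ≤ (Real.sqrt (2 * Real.pi * v))⁻¹ := by
      rw [gaussianPDFReal]
      have : Real.exp (-(s - 0) ^ 2 / (2 * v)) ≤ 1 := by
        apply Real.exp_le_one_iff.2
        apply div_nonpos_of_nonpos_of_nonneg
        · nlinarith [sq_nonneg (s - 0)]
        · positivity
      calc _ ≤ (Real.sqrt (2 * Real.pi * v))⁻¹ * 1 := by gcongr
        _ = _ := mul_one _
    calc _ ≤ (Real.sqrt (2 * Real.pi * v))⁻¹ * 1 := by
          gcongr
      _ = _ := mul_one _
  refine pl_one ?_ ?_ ?_ ?_ ?_ ?_ (bd f hf1) (bd g hg1) ha hb hab ?_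
  · exact (measurable_gaussianPDFReal 0 v).mul hf.ennreal_toReal
  · exact (measurable_gaussianPDFReal 0 v).mul hg.ennreal_toReal
  · exact (measurable_gaussianPDFReal 0 v).mul hh.ennreal_toReal
  · exact fun s => mul_nonneg (gaussianPDFReal_nonneg _ _ _) ENNReal.toReal_nonneg
  · exact fun s => mul_nonneg (gaussianPDFReal_nonneg _ _ _) ENNReal.toReal_nonneg
  · exact fun s => mul_nonneg (gaussianPDFReal_nonneg _ _ _) ENNReal.toReal_nonneg
  · intro s t
    have hht : h (a * s + b * t) ≠ ⊤ := ne_top_of_le_ne_top ENNReal.one_ne_top (hh1 _)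
    have h1 : (f s).toReal ^ a * (g t).toReal ^ b ≤ (h (a * s + b * t)).toReal := by
      have := ENNReal.toReal_mono hht (hc s t)
      rwa [ENNReal.toReal_mul, ← ENNReal.toReal_rpow, ← ENNReal.toReal_rpow] at this
    have h2 : gaussianPDFReal 0 v s ^ a * gaussianPDFReal 0 v t ^ b
        ≤ gaussianPDFReal 0 v (a * s + b * t) := by
      simp only [gaussianPDFReal]
      have hvp : (0 : ℝ) < v := by positivity
      have hi : 0 ≤ (Real.sqrt (2 * Real.pi * v))⁻¹ := by positivity
      rw [Real.mul_rpow hi (Real.exp_nonneg _), Real.mul_rpow hi (Real.exp_nonneg _),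
        mul_mul_mul_comm, ← Real.rpow_add_of_nonneg hi ha.le hb.le, hab, Real.rpow_one,
        ← Real.exp_mul, ← Real.exp_mul, ← Real.exp_add]
      gcongr
      have hb' : b = 1 - a := by linarith
      have : -(s - 0) ^ 2 / (2 * (v : ℝ)) * a + -(t - 0) ^ 2 / (2 * (v : ℝ)) * b =
        (-(a * s ^ 2 + b * t ^ 2)) / (2 * (v : ℝ)) := by field_simp; ring
      rw [this]
      gcongr
      subst hb'
      nlinarith [mul_nonneg (mul_nonneg ha.le hb.le) (sq_nonneg (s - t))]
    have p1 := gaussianPDFReal_nonneg 0 v s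
    have p2 := gaussianPDFReal_nonneg 0 v t
    rw [Real.mul_rpow p1 ENNReal.toReal_nonneg, Real.mul_rpow p2 ENNReal.toReal_nonneg,
      mul_mul_mul_comm]
    exact mul_le_mul h2 h1 (by positivity) (gaussianPDFReal_nonneg _ _ _)

theorem lmarginal_le_one {ι : Type*} [Fintype ι] [DecidableEq ι] (ν : ι → Measure ℝ)
    [∀ i, IsProbabilityMeasure (ν i)] (F : (ι → ℝ) → ENNReal) (hF1 : ∀ x, F x ≤ 1)
    (s : Finset ι) (x : ι → ℝ) : lmarginal ν s F x ≤ 1 := by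
  unfold lmarginal
  calc _ ≤ ∫⁻ y : (∀ i : s, ℝ), 1 ∂Measure.pi fun i : s => ν i := lintegral_mono fun y => hF1 _
    _ = 1 := by simp

theorem pl_pi {ι : Type*} [Fintype ι] [DecidableEq ι] {a b : ℝ} (ν : ι → Measure ℝ)
    [∀ i, IsProbabilityMeasure (ν i)] (hν : ∀ i, PLprop a b (ν i))
    (F G H : (ι → ℝ) → ENNReal) (hF : Measurable F) (hG : Measurable G) (hH : Measurable H)
    (hF1 : ∀ x, F x ≤ 1) (hG1 : ∀ x, G x ≤ 1) (hH1 : ∀ x, H x ≤ 1)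
    (hc : ∀ x y, F x ^ a * G y ^ b ≤ H (a • x + b • y)) :
    (∫⁻ x, F x ∂Measure.pi ν) ^ a * (∫⁻ x, G x ∂Measure.pi ν) ^ b ≤ ∫⁻ x, H x ∂Measure.pi ν := by
  have main : ∀ s : Finset ι, ∀ x y, (lmarginal ν s F x) ^ a * (lmarginal ν s G y) ^ b
      ≤ lmarginal ν s H (a • x + b • y) := by
    intro s
    induction s using Finset.induction with
    | empty => simpa using hc
    | insert i s hi ih =>
      intro x y
      rw [lmarginal_insert _ hF hi, lmarginal_insert _ hG hi, lmarginal_insert _ hH hi]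
      refine hν i _ _ _ ?_ ?_ ?_ ?_ ?_ ?_ ?_
      · exact (hF.lmarginal ν).comp (measurable_update x)
      · exact (hG.lmarginal ν).comp (measurable_update y)
      · exact (hH.lmarginal ν).comp (measurable_update _)
      · exact fun _ => lmarginal_le_one ν F hF1 _ _
      · exact fun _ => lmarginal_le_one ν G hG1 _ _
      · exact fun _ => lmarginal_le_one ν H hH1 _ _
      · intro r t
        refine (ih _ _).trans (le_of_eq ?_)
        congr 1
        ext j
        by_cases hj : j = i
        · subst hj; simp
        · simp [hj]
  have := main Finset.univ 0 0
  simpa using this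

/-- Quasi-concavity of product Gaussian measures. -/
theorem quasi_pi {ι : Type*} [Fintype ι] [DecidableEq ι] (v : ι → NNReal) (hv : ∀ i, v i ≠ 0)
    {a b : ℝ} (ha : 0 < a) (hb : 0 < b) (hab : a + b = 1)
    {A B C : Set (ι → ℝ)} (hA : MeasurableSet A) (hB : MeasurableSet B) (hC : MeasurableSet C)
    (hc : ∀ x ∈ A, ∀ y ∈ B, a • x + b • y ∈ C) :
    min (Measure.pi (fun i => gaussianReal 0 (v i)) A)
      (Measure.pi (fun i => gaussianReal 0 (v i)) B)
      ≤ Measure.pi (fun i => gaussianReal 0 (v i)) C := by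
  have := pl_pi (a := a) (b := b) (fun i => gaussianReal 0 (v i))
    (fun i => pl_gaussian (hv i) ha hb hab) (A.indicator 1) (B.indicator 1) (C.indicator 1)
    (measurable_one.indicator hA) (measurable_one.indicator hB) (measurable_one.indicator hC)
    (fun x => Set.indicator_le_self' (by simp) x |>.trans (by simp))
    (fun x => Set.indicator_le_self' (by simp) x |>.trans (by simp))
    (fun x => Set.indicator_le_self' (by simp) x |>.trans (by simp))
    (fun x y => by
      by_cases hx : x ∈ A
      · by_cases hy : y ∈ B
        · simp [hx, hy, hc x hx y hy]
        · simp [hy, hb]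
      · simp [hx, ha])
  rw [lintegral_indicator_one hA, lintegral_indicator_one hB, lintegral_indicator_one hC] at this
  refine le_trans ?_ this
  set m := min (Measure.pi (fun i => gaussianReal 0 (v i)) A)
      (Measure.pi (fun i => gaussianReal 0 (v i)) B)
  calc m = m ^ a * m ^ b := by
        rw [← ENNReal.rpow_add_of_nonneg _ _ ha.le hb.le, hab, ENNReal.rpow_one]
    _ ≤ _ := by
        gcongr
        · exact min_le_left _ _
        · exact min_le_right _ _

end part2

section part3
set_option linter.unusedSectionVars false

theorem cm_one {v : NNReal} (hv : v ≠ 0) (c : ℝ) :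
    gaussianReal (c * v) v = (gaussianReal 0 v).withDensity
      (fun s => ENNReal.ofReal (Real.exp (c * s - c ^ 2 * v / 2))) := by
  rw [gaussianReal_of_var_ne_zero _ hv, gaussianReal_of_var_ne_zero _ hv,
    ← withDensity_mul _ (measurable_gaussianPDF 0 v) (by fun_prop)]
  congr 1
  ext s
  have hvp : (0 : ℝ) < v := by positivity
  simp only [Pi.mul_apply, gaussianPDF]
  rw [← ENNReal.ofReal_mul (gaussianPDFReal_nonneg _ _ _)]
  simp only [gaussianPDFReal]
  rw [mul_assoc (Real.sqrt (2 * Real.pi * (v : ℝ)))⁻¹, ← Real.exp_add]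
  congr 3
  field_simp
  ring

section gen
variable {ι : Type*} [Fintype ι] [DecidableEq ι]

/-- product Gaussian measure -/
noncomputable def gpi (v : ι → NNReal) : Measure (ι → ℝ) :=
  Measure.pi fun i => gaussianReal 0 (v i)

instance (v : ι → NNReal) : IsProbabilityMeasure (gpi v) := by unfold gpi; infer_instance

theorem cm_pi (v : ι → NNReal) (hv : ∀ i, v i ≠ 0) (c : ι → ℝ) :
    (gpi v).map (fun g i => g i + c i * v i) = (gpi v).withDensity
      (fun g => ENNReal.ofReal (Real.exp (∑ i, c i * g i - (∑ i, c i ^ 2 * v i) / 2))) := by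
  unfold gpi
  rw [Measure.pi_map_pi (f := fun i s => s + c i * v i) (fun i => by fun_prop)]
  refine Measure.pi_eq ?_
  intro s hs
  have h1 : ∀ i, (gaussianReal 0 (v i)).map (fun t => t + c i * v i) =
      (gaussianReal 0 (v i)).withDensity
        (fun t => ENNReal.ofReal (Real.exp (c i * t - c i ^ 2 * v i / 2))) := by
    intro i; rw [gaussianReal_map_add_const, zero_add, cm_one (hv i)]
  have hms : MeasurableSet (Set.univ.pi s) := MeasurableSet.univ_pi hs
  rw [withDensity_apply _ hms, ← lintegral_indicator hms]
  simp_rw [h1]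
  have h2 : ∀ i, ((gaussianReal 0 (v i)).withDensity
        (fun t => ENNReal.ofReal (Real.exp (c i * t - c i ^ 2 * v i / 2)))) (s i) =
      ∫⁻ g : ι → ℝ, (s i).indicator
        (fun t => ENNReal.ofReal (Real.exp (c i * t - c i ^ 2 * v i / 2))) (g i)
        ∂(Measure.pi fun i => gaussianReal 0 (v i)) := by
    intro i
    rw [withDensity_apply _ (hs i), ← lintegral_indicator (hs i)]
    refine ((measurePreserving_eval (fun i => gaussianReal 0 (v i)) i).lintegral_comp ?_).symm
    exact Measurable.indicator (by fun_prop) (hs i)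
  simp_rw [h2]
  rw [← lintegral_prod_eq_prod_lintegral_of_indepFun]
  · congr 1; ext g
    by_cases hg : g ∈ Set.univ.pi s
    · rw [Set.indicator_of_mem hg]
      have : ∀ i, g i ∈ s i := fun i => hg i (Set.mem_univ i)
      simp only [this, Set.indicator_of_mem]
      rw [← ENNReal.ofReal_prod_of_nonneg (fun i _ => Real.exp_nonneg _), ← Real.exp_sum,
        Finset.sum_sub_distrib, Finset.sum_div]
    · rw [Set.indicator_of_notMem hg]
      simp only [Set.mem_pi, Set.mem_univ, true_implies, not_forall] at hg
      obtain ⟨i, hi⟩ := hg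
      rw [Finset.prod_eq_zero (Finset.mem_univ i)]
      rw [Set.indicator_of_notMem hi]
  · exact iIndepFun_pi (X := fun i => (s i).indicator
        (fun t => ENNReal.ofReal (Real.exp (c i * t - c i ^ 2 * v i / 2))))
      (fun i => (Measurable.indicator (by fun_prop) (hs i)).aemeasurable)
  · intro i
    exact (Measurable.indicator (by fun_prop) (hs i)).comp (measurable_pi_apply i)

theorem cm_lintegral (v : ι → NNReal) (hv : ∀ i, v i ≠ 0) (c : ι → ℝ)
    (f : (ι → ℝ) → ENNReal) (hf : Measurable f) :
    ∫⁻ g, f (fun i => g i + c i * v i) ∂(gpi v) =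
    ∫⁻ g, ENNReal.ofReal (Real.exp (∑ i, c i * g i - (∑ i, c i ^ 2 * v i) / 2)) * f g ∂(gpi v) := by
  have hm : Measurable (fun (g : ι → ℝ) i => g i + c i * (v i : ℝ)) := by fun_prop
  rw [← lintegral_map hf hm, cm_pi v hv, lintegral_withDensity_eq_lintegral_mul _ (by fun_prop) hf]
  rfl

theorem mgf_pi (v : ι → NNReal) (hv : ∀ i, v i ≠ 0) (c : ι → ℝ) :
    ∫⁻ g, ENNReal.ofReal (Real.exp (∑ i, c i * g i)) ∂(gpi v) =
      ENNReal.ofReal (Real.exp ((∑ i, c i ^ 2 * v i) / 2)) := by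
  have h := cm_lintegral v hv c (fun _ => 1) measurable_const
  simp only [lintegral_const, measure_univ, mul_one] at h
  have e : ∀ g : ι → ℝ, ENNReal.ofReal (Real.exp (∑ i, c i * g i)) =
      ENNReal.ofReal (Real.exp ((∑ i, c i ^ 2 * v i) / 2)) *
      ENNReal.ofReal (Real.exp (∑ i, c i * g i - (∑ i, c i ^ 2 * v i) / 2)) := by
    intro g
    rw [← ENNReal.ofReal_mul (Real.exp_nonneg _), ← Real.exp_add]; congr 2; ring
  simp_rw [e]
  rw [lintegral_const_mul _ (by fun_prop), ← h, mul_one]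

/-- If `C` is invariant under the Cameron–Martin shift, the exponential factors out. -/
theorem mgf_pi_inv (v : ι → NNReal) (hv : ∀ i, v i ≠ 0) (c : ι → ℝ) (C : Set (ι → ℝ))
    (hC : MeasurableSet C) (hinv : ∀ g, (fun i => g i + c i * v i) ∈ C ↔ g ∈ C) :
    ∫⁻ g in C, ENNReal.ofReal (Real.exp (∑ i, c i * g i)) ∂(gpi v) =
      ENNReal.ofReal (Real.exp ((∑ i, c i ^ 2 * v i) / 2)) * gpi v C := by
  have h := cm_lintegral v hv c (C.indicator 1) (measurable_one.indicator hC)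
  have e0 : ∀ g : ι → ℝ, C.indicator (1 : (ι → ℝ) → ENNReal) (fun i => g i + c i * v i)
      = C.indicator 1 g := by
    intro g; by_cases hg : g ∈ C
    · simp [hg, (hinv g).2 hg]
    · have : (fun i => g i + c i * (v i : ℝ)) ∉ C := fun h => hg ((hinv g).1 h)
      simp [hg, this]
  simp_rw [e0] at h
  rw [lintegral_indicator_one hC] at h
  have e : ∀ g : ι → ℝ, C.indicator (fun g => ENNReal.ofReal (Real.exp (∑ i, c i * g i))) g =
      ENNReal.ofReal (Real.exp ((∑ i, c i ^ 2 * v i) / 2)) *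
      (ENNReal.ofReal (Real.exp (∑ i, c i * g i - (∑ i, c i ^ 2 * v i) / 2))
        * C.indicator 1 g) := by
    intro g
    by_cases hg : g ∈ C
    · simp only [hg, Set.indicator_of_mem, Pi.one_apply, mul_one]
      rw [← ENNReal.ofReal_mul (Real.exp_nonneg _), ← Real.exp_add]; congr 2; ring
    · simp [hg]
  rw [← lintegral_indicator hC]
  simp_rw [e]
  rw [lintegral_const_mul, ← h]
  exact Measurable.mul (by fun_prop) (measurable_one.indicator hC)

/-- Gaussian tail with a constraint set invariant under the shift. -/
theorem tail_pi_inv (v : ι → NNReal) (hv : ∀ i, v i ≠ 0) (c : ι → ℝ) (C : Set (ι → ℝ))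
    (hC : MeasurableSet C) (hinv : ∀ g (t : ℝ), (fun i => g i + t * c i * v i) ∈ C ↔ g ∈ C)
    {V s : ℝ} (hV : ∑ i, c i ^ 2 * v i ≤ V) (hVp : 0 < V) (hs : 0 ≤ s) :
    gpi v (C ∩ {g | s ≤ ∑ i, c i * g i}) ≤
      ENNReal.ofReal (Real.exp (-(s ^ 2) / (2 * V))) * gpi v C := by
  set t := s / V with ht
  have ht0 : 0 ≤ t := by positivity
  have h := mgf_pi_inv v hv (fun i => t * c i) C hC (fun g => hinv g t)
  have hms : MeasurableSet {g : ι → ℝ | s ≤ ∑ i, c i * g i} :=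
    measurableSet_le measurable_const (by fun_prop)
  have h1 : ENNReal.ofReal (Real.exp (t * s)) * gpi v (C ∩ {g | s ≤ ∑ i, c i * g i})
      ≤ ∫⁻ g in C, ENNReal.ofReal (Real.exp (∑ i, t * c i * g i)) ∂(gpi v) := by
    calc _ = ∫⁻ g in (C ∩ {g | s ≤ ∑ i, c i * g i}), ENNReal.ofReal (Real.exp (t * s)) ∂(gpi v) := by
          rw [setLIntegral_const]
      _ ≤ ∫⁻ g in (C ∩ {g | s ≤ ∑ i, c i * g i}),
            ENNReal.ofReal (Real.exp (∑ i, t * c i * g i)) ∂(gpi v) := by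
          refine setLIntegral_mono' (hC.inter hms) ?_
          rintro g ⟨_, hg⟩
          apply ENNReal.ofReal_le_ofReal
          apply Real.exp_le_exp.2
          simp_rw [mul_assoc, ← Finset.mul_sum]
          exact mul_le_mul_of_nonneg_left hg ht0
      _ ≤ _ := lintegral_mono_set Set.inter_subset_left
  rw [h] at h1
  have h2 : gpi v (C ∩ {g | s ≤ ∑ i, c i * g i}) = ENNReal.ofReal (Real.exp (-(t * s))) *
      (ENNReal.ofReal (Real.exp (t * s)) * gpi v (C ∩ {g | s ≤ ∑ i, c i * g i})) := by
    rw [← mul_assoc, ← ENNReal.ofReal_mul (Real.exp_nonneg _), ← Real.exp_add]; simp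
  rw [h2]
  calc _ ≤ ENNReal.ofReal (Real.exp (-(t * s))) *
        (ENNReal.ofReal (Real.exp ((∑ i, (t * c i) ^ 2 * v i) / 2)) * gpi v C) := by gcongr
    _ ≤ _ := by
        rw [← mul_assoc, ← ENNReal.ofReal_mul (Real.exp_nonneg _), ← Real.exp_add]
        gcongr
        have e : ∑ i, (t * c i) ^ 2 * (v i : ℝ) = t ^ 2 * ∑ i, c i ^ 2 * v i := by
          rw [Finset.mul_sum]; congr 1; ext i; ring
        rw [e]
        have : t ^ 2 * ∑ i, c i ^ 2 * (v i : ℝ) ≤ t ^ 2 * V := by gcongr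
        have e2 : t ^ 2 * V = s ^ 2 / V := by rw [ht]; field_simp
        have e3 : t * s = s ^ 2 / V := by rw [ht]; field_simp
        have e4 : -(s ^ 2) / (2 * V) = -(s ^ 2 / V) / 2 := by field_simp
        rw [e4]; linarith

theorem tail_pi (v : ι → NNReal) (hv : ∀ i, v i ≠ 0) (c : ι → ℝ) {V s : ℝ}
    (hV : ∑ i, c i ^ 2 * v i ≤ V) (hVp : 0 < V) (hs : 0 ≤ s) :
    gpi v {g | s ≤ ∑ i, c i * g i} ≤ ENNReal.ofReal (Real.exp (-(s ^ 2) / (2 * V))) := by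
  have := tail_pi_inv v hv c Set.univ MeasurableSet.univ (by simp) (s := s) hV hVp hs
  simpa using this

theorem hyperplane_null (v : ι → NNReal) (hv : ∀ i, v i ≠ 0) (c : ι → ℝ) (j : ι) (hj : c j ≠ 0)
    (r : ℝ) : gpi v {g | ∑ i, c i * g i = r} = 0 := by
  have hm : MeasurableSet {g : ι → ℝ | ∑ i, c i * g i = r} :=
    measurableSet_eq_fun (by fun_prop) measurable_const
  rw [← lintegral_indicator_one hm]
  unfold gpi
  rw [lintegral_eq_lmarginal_univ 0,
    lmarginal_erase' _ (measurable_one.indicator hm) (Finset.mem_univ j)]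
  have : (fun x : ι → ℝ => ∫⁻ t, ({g : ι → ℝ | ∑ i, c i * g i = r}.indicator 1
      (Function.update x j t) : ENNReal) ∂(gaussianReal 0 (v j))) = fun _ => 0 := by
    ext x
    set t0 := (r - ∑ i ∈ Finset.univ.erase j, c i * x i) / c j with ht0
    have h1 : ∀ t, ({g : ι → ℝ | ∑ i, c i * g i = r}.indicator 1
      (Function.update x j t) : ENNReal) ≤ ({t0} : Set ℝ).indicator 1 t := by
      intro t
      by_cases h : Function.update x j t ∈ {g : ι → ℝ | ∑ i, c i * g i = r}
      · have h' : ∑ i, c i * Function.update x j t i = r := h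
        rw [← Finset.add_sum_erase _ _ (Finset.mem_univ j)] at h'
        have e : ∑ i ∈ Finset.univ.erase j, c i * Function.update x j t i
            = ∑ i ∈ Finset.univ.erase j, c i * x i := by
          apply Finset.sum_congr rfl
          intro i hi
          rw [Function.update_of_ne (Finset.ne_of_mem_erase hi)]
        rw [e, Function.update_self] at h'
        have : t = t0 := by rw [ht0]; field_simp; linarith
        subst this
        simp [Set.indicator_of_mem h]
      · simp [Set.indicator_of_notMem h]
    have := nullSingletonClass_gaussianReal (μ := 0) (hv j)
    refine le_antisymm ((lintegral_mono h1).trans ?_) zero_le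
    rw [lintegral_indicator_one (measurableSet_singleton _)]
    simp
  rw [this]
  simp [lmarginal]

end gen

end part3

section part4
set_option linter.unusedSimpArgs false

section goe
variable {n : ℕ}

noncomputable def vr (n : ℕ) (p : Fin n × Fin n) : NNReal :=
  if p.1 = p.2 then 2 / (n : NNReal) else 1 / (n : NNReal)

noncomputable def mu (n : ℕ) : Measure (Fin n × Fin n → ℝ) := gpi (vr n)

instance (n : ℕ) : IsProbabilityMeasure (mu n) := by unfold mu; infer_instance

def symG (g : Fin n × Fin n → ℝ) : Fin n → Fin n → ℝ := fun i j => g (min i j, max i j)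

noncomputable def Qf (S : Finset (Fin n)) (g : Fin n × Fin n → ℝ) : ℝ := quadForm (symG g) S

noncomputable def coef (S : Finset (Fin n)) (p : Fin n × Fin n) : ℝ :=
  if p.1 ∈ S ∧ p.2 ∈ S then (if p.1 < p.2 then 2 else if p.1 = p.2 then 1 else 0) else 0

theorem goe_eq (n : ℕ) : goeMeasure n = (mu n).map symG := rfl

theorem vr_ne (hn : 0 < n) (p : Fin n × Fin n) : vr n p ≠ 0 := by
  have : (n : NNReal) ≠ 0 := by exact_mod_cast hn.ne'
  unfold vr; split_ifs <;> simp [this]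

theorem symG_symm (g : Fin n × Fin n → ℝ) (i j : Fin n) : symG g i j = symG g j i := by
  unfold symG; rw [min_comm, max_comm]

theorem Qf_eq (S : Finset (Fin n)) (g : Fin n × Fin n → ℝ) :
    Qf S g = ∑ p, coef S p * g p := by
  have h1 : Qf S g = ∑ i, ∑ j, if i ∈ S ∧ j ∈ S then g (min i j, max i j) else 0 := by
    unfold Qf quadForm symG
    rw [← Finset.sum_filter_add_sum_filter_not Finset.univ (fun i => i ∈ S)]
    have h0 : ∑ i ∈ Finset.univ.filter (fun i => ¬ i ∈ S),
        ∑ j, (if i ∈ S ∧ j ∈ S then g (min i j, max i j) else 0) = 0 := by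
      apply Finset.sum_eq_zero
      intro i hi
      have : i ∉ S := by simpa using hi
      simp [this]
    rw [h0, add_zero, Finset.filter_mem_eq_inter, Finset.univ_inter]
    apply Finset.sum_congr rfl
    intro i hi
    simp [hi, ← Finset.sum_filter, Finset.filter_mem_eq_inter]
  have h2 : ∀ i j : Fin n, (if i ∈ S ∧ j ∈ S then g (min i j, max i j) else 0) =
      (if i ∈ S ∧ j ∈ S ∧ i < j then g (i, j) else 0) +
      (if i ∈ S ∧ j ∈ S ∧ i = j then g (i, j) else 0) +
      (if i ∈ S ∧ j ∈ S ∧ j < i then g (j, i) else 0) := by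
    intro i j
    by_cases hi : i ∈ S
    · by_cases hj : j ∈ S
      · rcases lt_trichotomy i j with h | h | h
        · simp [hi, hj, h, h.le, h.ne, h.not_gt]
        · subst h; simp [hi]
        · simp [hi, hj, h, h.le, h.ne', h.not_gt]
      · simp [hj]
    · simp [hi]
  rw [h1]
  simp_rw [h2, Finset.sum_add_distrib]
  have h3 : ∑ i : Fin n, ∑ j : Fin n, (if i ∈ S ∧ j ∈ S ∧ j < i then g (j, i) else 0)
      = ∑ i : Fin n, ∑ j : Fin n, (if i ∈ S ∧ j ∈ S ∧ i < j then g (i, j) else 0) := by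
    rw [Finset.sum_comm]
    apply Finset.sum_congr rfl; intro i _
    apply Finset.sum_congr rfl; intro j _
    congr 1
    simp only [eq_iff_iff]; tauto
  rw [h3, Fintype.sum_prod_type, ← Finset.sum_add_distrib, ← Finset.sum_add_distrib]
  apply Finset.sum_congr rfl; intro i _
  rw [← Finset.sum_add_distrib, ← Finset.sum_add_distrib]
  apply Finset.sum_congr rfl; intro j _
  unfold coef
  by_cases hi : i ∈ S
  · by_cases hj : j ∈ S
    · rcases lt_trichotomy i j with h | h | h
      · simp [hi, hj, h, h.ne, two_mul]
      · subst h; simp [hi]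
      · simp [hi, hj, h.ne', h.not_gt]
    · simp [hj]
  · simp [hi]

theorem Qf_meas (S : Finset (Fin n)) : Measurable (Qf S) := by
  have : Qf S = fun g => ∑ p, coef S p * g p := by ext g; exact Qf_eq S g
  rw [this]; fun_prop

theorem coef_sum (S : Finset (Fin n)) : ∑ p, coef S p = (S.card : ℝ) ^ 2 := by
  have := Qf_eq S (fun _ => 1)
  simp only [mul_one] at this
  rw [← this]; simp [Qf, quadForm, symG, sq]

theorem coef_dot (u v : Finset (Fin n)) :
    ∑ p, coef u p * coef v p * (vr n p : ℝ) = 2 / n * ((u ∩ v).card : ℝ) ^ 2 := by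
  rw [← coef_sum, Finset.mul_sum]
  apply Finset.sum_congr rfl
  rintro ⟨i, j⟩ _
  simp only [coef, vr, Finset.mem_inter]
  by_cases hij : i < j
  · have : i ≠ j := hij.ne
    simp only [hij, if_true, this, if_false]
    split_ifs <;> first | (exfalso; tauto) | (push_cast; ring)
  · by_cases h2 : i = j
    · simp only [hij, h2, if_true, if_false, lt_irrefl]
      split_ifs <;> first | (exfalso; tauto) | (push_cast; ring)
    · simp [hij, h2]

theorem Qf_shift (S u w : Finset (Fin n)) (g : Fin n × Fin n → ℝ) (a b : ℝ) :
    Qf S (fun p => g p + (a * coef u p - b * coef w p) * vr n p) =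
      Qf S g + a * (2 / n) * ((S ∩ u).card : ℝ) ^ 2 - b * (2 / n) * ((S ∩ w).card : ℝ) ^ 2 := by
  rw [Qf_eq, Qf_eq, mul_assoc a, mul_assoc b, ← coef_dot, ← coef_dot, Finset.mul_sum,
    Finset.mul_sum, ← Finset.sum_add_distrib, ← Finset.sum_sub_distrib]
  apply Finset.sum_congr rfl
  intro p _; ring

theorem coef_diff_var (u w : Finset (Fin n)) :
    ∑ p, (coef u p - coef w p) ^ 2 * (vr n p : ℝ) =
      2 / n * ((u.card : ℝ) ^ 2 + (w.card : ℝ) ^ 2 - 2 * ((u ∩ w).card : ℝ) ^ 2) := by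
  have h1 := coef_dot u u
  have h2 := coef_dot w w
  have h3 := coef_dot u w
  rw [Finset.inter_self] at h1 h2
  have : ∑ p, (coef u p - coef w p) ^ 2 * (vr n p : ℝ) = ∑ p, coef u p * coef u p * (vr n p : ℝ) +
      ∑ p, coef w p * coef w p * (vr n p : ℝ) - 2 * ∑ p, coef u p * coef w p * (vr n p : ℝ) := by
    rw [Finset.mul_sum, ← Finset.sum_add_distrib, ← Finset.sum_sub_distrib]
    apply Finset.sum_congr rfl
    intro p _; ring
  rw [this, h1, h2, h3]; ring

theorem coef_var (u : Finset (Fin n)) :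
    ∑ p, (coef u p) ^ 2 * (vr n p : ℝ) = 2 / n * (u.card : ℝ) ^ 2 := by
  rw [← Finset.inter_self u, ← coef_dot u u, Finset.inter_self]
  apply Finset.sum_congr rfl
  intro p _; ring

theorem coef_inj {u w : Finset (Fin n)} (h : u ≠ w) : ∃ p, coef u p - coef w p ≠ 0 := by
  by_contra! hc
  apply h
  ext i
  have := hc (i, i)
  simp only [coef, and_self, lt_irrefl, if_false, if_true] at this
  by_cases h1 : i ∈ u <;> by_cases h2 : i ∈ w <;> simp_all

theorem no_tie (hn : 0 < n) {u w : Finset (Fin n)} (h : u ≠ w) :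
    mu n {g | Qf u g = Qf w g} = 0 := by
  obtain ⟨p, hp⟩ := coef_inj h
  have := hyperplane_null (vr n) (vr_ne hn) (fun p => coef u p - coef w p) p hp 0
  unfold mu
  refine measure_mono_null ?_ this
  intro g hg
  have hg' : Qf u g = Qf w g := hg
  simp only [Set.mem_ofPred_eq, sub_mul, Finset.sum_sub_distrib]
  rw [← Qf_eq, ← Qf_eq, hg', sub_self]

theorem Qf_tail (hn : 0 < n) (S : Finset (Fin n)) (hS : 0 < S.card) {s : ℝ} (hs : 0 ≤ s) :
    mu n {g | s ≤ |Qf S g|} ≤ 2 * ENNReal.ofReal (Real.exp (-(s ^ 2 * n) / (4 * (S.card : ℝ) ^ 2))) := by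
  have hn' : (0 : ℝ) < n := by exact_mod_cast hn
  have hS' : (0 : ℝ) < S.card := by exact_mod_cast hS
  have h1 := tail_pi (vr n) (vr_ne hn) (coef S) (V := 2 / n * (S.card : ℝ) ^ 2) (coef_var S).le
    (by positivity) hs
  have h2 := tail_pi (vr n) (vr_ne hn) (fun p => - coef S p) (V := 2 / n * (S.card : ℝ) ^ 2)
    (by simpa using (coef_var S).le) (by positivity) hs
  have e : -(s ^ 2) / (2 * (2 / n * (S.card : ℝ) ^ 2)) = -(s ^ 2 * n) / (4 * (S.card : ℝ) ^ 2) := by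
    field_simp; ring
  rw [e] at h1 h2
  rw [two_mul]
  refine le_trans (measure_mono ?_) ((measure_union_le _ _).trans (add_le_add h1 h2))
  intro g hg
  have hg' : s ≤ |Qf S g| := hg
  rcases le_abs.1 hg' with h | h
  · left; simpa [Qf_eq] using h
  · right; simpa [Qf_eq] using h

/-- permutation action -/
def permE (σ : Equiv.Perm (Fin n)) (p : Fin n × Fin n) : Fin n × Fin n :=
  if p.1 ≤ p.2 then (min (σ p.1) (σ p.2), max (σ p.1) (σ p.2))
    else (max (σ p.1) (σ p.2), min (σ p.1) (σ p.2))

theorem permE_inv (σ : Equiv.Perm (Fin n)) (p : Fin n × Fin n) :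
    permE σ⁻¹ (permE σ p) = p := by
  obtain ⟨i, j⟩ := p
  unfold permE
  rcases lt_trichotomy i j with h | h | h
  · have hne : σ i ≠ σ j := fun e => h.ne (σ.injective e)
    rcases lt_or_gt_of_ne hne with h' | h'
    · simp [h.le, h'.le]
    · simp [h.le, h'.le]
  · subst h; simp
  · have hne : σ i ≠ σ j := fun e => h.ne' (σ.injective e)
    rcases lt_or_gt_of_ne hne with h' | h'
    · simp [h.le, h'.le, h'.not_ge, h.not_ge]
    · simp [h.le, h'.le, h'.not_ge, h.not_ge]

def permEquiv (σ : Equiv.Perm (Fin n)) : Equiv.Perm (Fin n × Fin n) where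
  toFun := permE σ
  invFun := permE σ⁻¹
  left_inv := permE_inv σ
  right_inv := fun p => by simpa using permE_inv σ⁻¹ p

theorem permEquiv_apply (σ : Equiv.Perm (Fin n)) (p : Fin n × Fin n) :
    permEquiv σ p = permE σ p := rfl

def permT (σ : Equiv.Perm (Fin n)) (g : Fin n × Fin n → ℝ) : Fin n × Fin n → ℝ :=
  fun p => g (permEquiv σ p)

theorem symG_permT (σ : Equiv.Perm (Fin n)) (g : Fin n × Fin n → ℝ) (i j : Fin n) :
    symG (permT σ g) i j = symG g (σ i) (σ j) := by
  unfold symG permT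
  rw [permEquiv_apply]
  unfold permE
  simp only [min_le_max, if_true]
  rcases le_total i j with h | h
  · simp [h]
  · simp [h, min_comm, max_comm]

theorem Qf_permT (σ : Equiv.Perm (Fin n)) (g : Fin n × Fin n → ℝ) (S : Finset (Fin n)) :
    Qf S (permT σ g) = Qf (S.map σ.toEmbedding) g := by
  unfold Qf quadForm
  simp [symG_permT]

theorem permT_mp (σ : Equiv.Perm (Fin n)) : MeasurePreserving (permT σ) (mu n) (mu n) := by
  have h := measurePreserving_piCongrLeft (fun p : Fin n × Fin n => gaussianReal 0 (vr n p))
    (permEquiv σ).symm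
  have hvr : ∀ p, vr n ((permEquiv σ) p) = vr n p := by
    rintro ⟨i, j⟩
    rw [permEquiv_apply]
    unfold vr
    have : (permE σ (i, j)).1 = (permE σ (i, j)).2 ↔ i = j := by
      constructor
      · intro e
        apply σ.injective
        unfold permE at e
        split_ifs at e with h
        · rcases le_total (σ i) (σ j) with h' | h' <;> simp [h'] at e <;> simp [e]
        · rcases le_total (σ i) (σ j) with h' | h' <;> simp [h'] at e <;> simp [e]
      · rintro rfl; simp [permE]
    simp only [this]
  have hvr' : ∀ p, vr n ((permEquiv σ).symm p) = vr n p := by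
    intro p
    rw [← hvr ((permEquiv σ).symm p), Equiv.apply_symm_apply]
  simp_rw [hvr'] at h
  have e : permT σ = ⇑(MeasurableEquiv.piCongrLeft (fun _ : Fin n × Fin n => ℝ)
      (permEquiv σ).symm) := by
    ext g p
    obtain ⟨q, rfl⟩ := (permEquiv σ).symm.surjective p
    rw [MeasurableEquiv.coe_piCongrLeft, Equiv.piCongrLeft_apply_apply]
    simp [permT]
  rw [e]
  exact h

end goe

end part4

section part5
set_option linter.unusedSimpArgs false

section upper
variable {n : ℕ}

/-- event that `v` maximizes the energy with external field `y` among `K`-sets -/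
def Cv (K : ℕ) (y : Fin n → ℝ) (v : Finset (Fin n)) : Set (Fin n × Fin n → ℝ) :=
  {g | ∀ u : Finset (Fin n), u.card = K → Qf u g + ∑ i ∈ u, y i ≤ Qf v g + ∑ i ∈ v, y i}

theorem Cv_meas (K : ℕ) (y : Fin n → ℝ) (v : Finset (Fin n)) : MeasurableSet (Cv K y v) := by
  have : Cv K y v = ⋂ u : Finset (Fin n), ⋂ _ : u.card = K,
      {g | Qf u g + ∑ i ∈ u, y i ≤ Qf v g + ∑ i ∈ v, y i} := by
    ext g; simp [Cv]
  rw [this]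
  refine MeasurableSet.iInter fun u => MeasurableSet.iInter fun _ => ?_
  exact measurableSet_le ((Qf_meas u).add_const _) ((Qf_meas v).add_const _)

theorem Qf_lin (S : Finset (Fin n)) (g g' : Fin n × Fin n → ℝ) (a b : ℝ) :
    Qf S (a • g + b • g') = a * Qf S g + b * Qf S g' := by
  simp only [Qf_eq, Finset.mul_sum, ← Finset.sum_add_distrib]
  apply Finset.sum_congr rfl
  intro p _; simp; ring

theorem Cv_convex (hn : 0 < n) (K : ℕ) (v : Finset (Fin n)) (r : ENNReal) :
    Convex ℝ {y : Fin n → ℝ | r ≤ mu n (Cv K y v)} := by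
  rw [convex_iff_forall_pos]
  intro y1 h1 y2 h2 a b ha hb hab
  have h := quasi_pi (vr n) (vr_ne hn) ha hb hab (Cv_meas K y1 v) (Cv_meas K y2 v)
    (Cv_meas K (a • y1 + b • y2) v) (by
      intro g hg g' hg' u hu
      have e1 := hg u hu
      have e2 := hg' u hu
      rw [Qf_lin, Qf_lin]
      simp only [Pi.add_apply, Pi.smul_apply, smul_eq_mul, Finset.sum_add_distrib,
        ← Finset.mul_sum]
      nlinarith)
  exact le_trans (le_min h1 h2) h

theorem Cv_perm (K : ℕ) (y : Fin n → ℝ) (v : Finset (Fin n)) (σ : Equiv.Perm (Fin n)) :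
    permT σ ⁻¹' (Cv K (fun i => y (σ i)) v) = Cv K y (v.map σ.toEmbedding) := by
  ext g
  have e : ∀ u : Finset (Fin n), ∑ i ∈ u, y (σ i) = ∑ i ∈ u.map σ.toEmbedding, y i := by
    intro u; simp
  simp only [Set.mem_preimage, Cv, Set.mem_setOf_eq, Qf_permT, e]
  constructor
  · intro h u hu
    have := h (u.map σ.symm.toEmbedding) (by simpa using hu)
    rw [Finset.map_map] at this
    have e2 : σ.symm.toEmbedding.trans σ.toEmbedding = Function.Embedding.refl _ := by
      ext i; simp
    rwa [e2, Finset.map_refl] at this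
  · intro h u hu
    exact h _ (by simpa using hu)

theorem Cv_perm_measure (K : ℕ) (y : Fin n → ℝ) (v : Finset (Fin n)) (σ : Equiv.Perm (Fin n)) :
    mu n (Cv K (fun i => y (σ i)) v) = mu n (Cv K y (v.map σ.toEmbedding)) := by
  rw [← Cv_perm, (permT_mp σ).measure_preimage (Cv_meas _ _ _).nullMeasurableSet]

open Classical in
noncomputable def stab (v : Finset (Fin n)) : Finset (Equiv.Perm (Fin n)) :=
  Finset.univ.filter fun σ => v.map σ.toEmbedding = v

theorem stab_mem (v : Finset (Fin n)) (σ : Equiv.Perm (Fin n)) :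
    σ ∈ stab v ↔ v.map σ.toEmbedding = v := by simp [stab]

theorem stab_mem' (v : Finset (Fin n)) (σ : Equiv.Perm (Fin n)) :
    σ ∈ stab v ↔ ∀ i, i ∈ v → σ i ∈ v := by
  rw [stab_mem]
  constructor
  · intro h i hi
    rw [← h]; simpa using hi
  · intro h
    apply Finset.eq_of_subset_of_card_le
    · intro j hj
      simp only [Finset.mem_map, Equiv.coe_toEmbedding] at hj
      obtain ⟨i, hi, rfl⟩ := hj
      exact h i hi
    · simp

noncomputable def avg (v : Finset (Fin n)) (y : Fin n → ℝ) : Fin n → ℝ :=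
  ∑ σ ∈ stab v, ((stab v).card : ℝ)⁻¹ • fun i => y (σ i)

theorem stab_pos (v : Finset (Fin n)) : 0 < (stab v).card := by
  apply Finset.card_pos.2
  exact ⟨1, (stab_mem' v 1).2 (by simp)⟩

theorem Cv_avg (hn : 0 < n) (K : ℕ) (y : Fin n → ℝ) (v : Finset (Fin n)) :
    mu n (Cv K y v) ≤ mu n (Cv K (avg v y) v) := by
  have hp : (0 : ℝ) < (stab v).card := by exact_mod_cast stab_pos v
  refine (Cv_convex hn K v (mu n (Cv K y v))).sum_mem (fun σ _ => by positivity) ?_ ?_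
  · simp; field_simp
  · intro σ hσ
    simp only [Set.mem_setOf_eq]
    rw [Cv_perm_measure, (stab_mem v σ).1 hσ]

theorem avg_nonneg (v : Finset (Fin n)) (y : Fin n → ℝ) (hy : ∀ i, 0 ≤ y i) (i : Fin n) :
    0 ≤ avg v y i := by
  simp only [avg, Finset.sum_apply, Pi.smul_apply, smul_eq_mul]
  exact Finset.sum_nonneg fun σ _ => mul_nonneg (by positivity) (hy _)

theorem avg_const (v : Finset (Fin n)) (y : Fin n → ℝ) (i j : Fin n) (hi : i ∈ v) (hj : j ∈ v) :
    avg v y i = avg v y j := by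
  simp only [avg, Finset.sum_apply, Pi.smul_apply, smul_eq_mul]
  refine Finset.sum_bij' (fun σ _ => σ * Equiv.swap i j) (fun σ _ => σ * Equiv.swap i j) ?_ ?_ ?_ ?_ ?_
  · intro σ hσ
    rw [stab_mem'] at hσ ⊢
    intro l hl
    apply hσ
    rw [Equiv.swap_apply_def]; split_ifs <;> assumption
  · intro σ hσ
    rw [stab_mem'] at hσ ⊢
    intro l hl
    apply hσ
    rw [Equiv.swap_apply_def]; split_ifs <;> assumption
  · intro σ _; simp [mul_assoc]
  · intro σ _; simp [mul_assoc]
  · intro σ _; simp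

theorem avg_sum (v : Finset (Fin n)) (y : Fin n → ℝ) :
    ∑ i ∈ v, avg v y i = ∑ i ∈ v, y i := by
  have hp : (0 : ℝ) < (stab v).card := by exact_mod_cast stab_pos v
  simp only [avg, Finset.sum_apply, Pi.smul_apply, smul_eq_mul]
  rw [Finset.sum_comm]
  have : ∀ σ ∈ stab v, ∑ i ∈ v, ((stab v).card : ℝ)⁻¹ * y (σ i) =
      ((stab v).card : ℝ)⁻¹ * ∑ i ∈ v, y i := by
    intro σ hσ
    rw [← Finset.mul_sum]
    congr 1
    conv_rhs => rw [← (stab_mem v σ).1 hσ]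
    simp
  rw [Finset.sum_congr rfl this, Finset.sum_const, nsmul_eq_mul]
  field_simp

theorem avg_val (v : Finset (Fin n)) (y : Fin n → ℝ) (i : Fin n) (hi : i ∈ v) :
    avg v y i = (∑ i ∈ v, y i) / v.card := by
  have hv : (0 : ℝ) < v.card := by exact_mod_cast Finset.card_pos.2 ⟨i, hi⟩
  rw [← avg_sum v y, Finset.sum_congr rfl (fun j hj => avg_const v y j i hj hi)]
  simp; field_simp

theorem Cv_shift {K : ℕ} (hK : 0 < K) (hn : 0 < n) (y : Fin n → ℝ) (hy : ∀ i, 0 ≤ y i)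
    (v : Finset (Fin n)) (hv : v.card = K) {A : ℝ} (hA : ∑ i ∈ v, y i = A) (g : Fin n × Fin n → ℝ)
    (hg : g ∈ Cv K (avg v y) v) :
    (fun p => g p + (A * n / (2 * K ^ 2)) * coef v p * vr n p) ∈ Cv K 0 v := by
  intro u hu
  have h1 := hg u hu
  have hK' : (0 : ℝ) < K := by exact_mod_cast hK
  have hn' : (0 : ℝ) < n := by exact_mod_cast hn
  have hA0 : 0 ≤ A := by rw [← hA]; exact Finset.sum_nonneg fun i _ => hy i
  have sh : ∀ S : Finset (Fin n), Qf S (fun p => g p + (A * n / (2 * K ^ 2)) * coef v p * vr n p) =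
      Qf S g + A / K ^ 2 * ((S ∩ v).card : ℝ) ^ 2 := by
    intro S
    have := Qf_shift S v v g (A * n / (2 * K ^ 2)) 0
    simp only [zero_mul, sub_zero] at this
    rw [this]; congr 1; field_simp
  rw [sh, sh, Finset.inter_self, hv]
  rw [avg_sum, hA] at h1
  have h2 : ((u ∩ v).card : ℝ) * (A / K) ≤ ∑ i ∈ u, avg v y i := by
    calc ((u ∩ v).card : ℝ) * (A / K) = ∑ i ∈ u ∩ v, avg v y i := by
          rw [Finset.sum_congr rfl (fun j hj => avg_val v y j (Finset.mem_inter.1 hj).2), hA, hv]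
          simp
      _ ≤ _ := Finset.sum_le_sum_of_subset_of_nonneg Finset.inter_subset_left
          (fun i _ _ => avg_nonneg v y hy i)
  set q : ℝ := ((u ∩ v).card : ℝ) with hq
  have hqK : q ≤ K := by
    rw [hq, ← hv]; exact_mod_cast Finset.card_le_card Finset.inter_subset_right
  have hq0 : 0 ≤ q := by positivity
  simp only [Pi.zero_apply, Finset.sum_const_zero, add_zero]
  have h3 : A / K ^ 2 * q ^ 2 ≤ q * (A / K) := by
    have : A / K ^ 2 * q ^ 2 = (A / K) * (q * (q / K)) := by field_simp
    rw [this, mul_comm q (A / K)]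
    have : q / K ≤ 1 := by rw [div_le_one hK']; exact hqK
    have hAK : 0 ≤ A / K := by positivity
    have := mul_le_mul_of_nonneg_left this hq0
    nlinarith
  have h4 : A / K ^ 2 * (K : ℝ) ^ 2 = A := by field_simp
  linarith

theorem Cv_bound1 {K : ℕ} (hK : 0 < K) (hn : 0 < n) (y : Fin n → ℝ) (hy : ∀ i, 0 ≤ y i)
    (v : Finset (Fin n)) (hv : v.card = K) {A : ℝ} (hA : ∑ i ∈ v, y i = A) :
    mu n (Cv K y v) ≤ ∫⁻ g in Cv K 0 v,
      ENNReal.ofReal (Real.exp ((A * n / (2 * K ^ 2)) * Qf v g)) ∂(mu n) := by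
  refine (Cv_avg hn K y v).trans ?_
  set t := A * n / (2 * (K : ℝ) ^ 2) with ht
  have h := cm_lintegral (vr n) (vr_ne hn) (fun p => t * coef v p)
    ((Cv K 0 v).indicator 1) (measurable_one.indicator (Cv_meas K 0 v))
  calc mu n (Cv K (avg v y) v) = ∫⁻ g, (Cv K (avg v y) v).indicator 1 g ∂(mu n) := by
        rw [lintegral_indicator_one (Cv_meas _ _ _)]
    _ ≤ ∫⁻ g, (Cv K 0 v).indicator 1 (fun p => g p + t * coef v p * vr n p) ∂(mu n) := by
        refine lintegral_mono fun g => ?_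
        by_cases hg : g ∈ Cv K (avg v y) v
        · have := Cv_shift hK hn y hy v hv hA g hg
          rw [Set.indicator_of_mem hg, Set.indicator_of_mem this]
          simp
        · rw [Set.indicator_of_notMem hg]; exact zero_le
    _ = _ := h
    _ ≤ _ := by
        rw [← lintegral_indicator (Cv_meas _ _ _)]
        refine lintegral_mono fun g => ?_
        by_cases hg : g ∈ Cv K 0 v
        · simp only [Set.indicator_of_mem hg, Pi.one_apply, mul_one]
          apply ENNReal.ofReal_le_ofReal
          apply Real.exp_le_exp.2
          have e : ∑ p, t * coef v p * g p = t * Qf v g := by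
            rw [Qf_eq, Finset.mul_sum]; simp_rw [mul_assoc]
          rw [e]
          have : 0 ≤ (∑ p, (t * coef v p) ^ 2 * (vr n p : ℝ)) := by positivity
          linarith
        · simp [hg]

theorem Cv_int_perm (K : ℕ) (t : ℝ) (v : Finset (Fin n)) (σ : Equiv.Perm (Fin n)) :
    ∫⁻ g in Cv K 0 (v.map σ.toEmbedding),
      ENNReal.ofReal (Real.exp (t * Qf (v.map σ.toEmbedding) g)) ∂(mu n) =
    ∫⁻ g in Cv K 0 v, ENNReal.ofReal (Real.exp (t * Qf v g)) ∂(mu n) := by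
  have h := (permT_mp σ).setLIntegral_comp_preimage (Cv_meas K 0 v)
    (f := fun g => ENNReal.ofReal (Real.exp (t * Qf v g))) (by
      have := Qf_meas v; fun_prop)
  rw [← h]
  have e : permT σ ⁻¹' (Cv K 0 v) = Cv K 0 (v.map σ.toEmbedding) := Cv_perm K 0 v σ
  rw [e]; simp_rw [Qf_permT]

theorem exists_perm_map {u v : Finset (Fin n)} (h : u.card = v.card) :
    ∃ σ : Equiv.Perm (Fin n), u.map σ.toEmbedding = v := by
  classical
  have e : {i // i ∈ u} ≃ {i // i ∈ v} := Fintype.equivOfCardEq (by simpa using h)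
  refine ⟨e.extendSubtype, ?_⟩
  apply Finset.eq_of_subset_of_card_le
  · intro j hj
    simp only [Finset.mem_map, Equiv.coe_toEmbedding] at hj
    obtain ⟨i, hi, rfl⟩ := hj
    exact e.extendSubtype_mem i hi
  · simp [h]

theorem ae_no_tie (hn : 0 < n) : ∀ᵐ g ∂(mu n), ∀ u w : Finset (Fin n), u ≠ w → Qf u g ≠ Qf w g := by
  rw [ae_all_iff]; intro u
  rw [ae_all_iff]; intro w
  by_cases h : u = w
  · simp [h]
  · have := no_tie hn h
    simp only [ne_eq, h, not_false_eq_true, true_implies]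
    exact measure_eq_zero_iff_ae_notMem.1 this

theorem exp_trick {t G Q M : ℝ} (ht : 0 ≤ t) (hG : t ≤ G) :
    Real.exp (t * Q) ≤ Real.exp (t * M) * (1 + Real.exp (G * (Q - M))) := by
  rcases le_total Q M with h | h
  · have : Real.exp (t * Q) ≤ Real.exp (t * M) := Real.exp_le_exp.2 (by gcongr)
    nlinarith [Real.exp_pos (t * M), Real.exp_pos (G * (Q - M))]
  · have : Real.exp (t * Q) = Real.exp (t * M) * Real.exp (t * (Q - M)) := by
      rw [← Real.exp_add]; congr 1; ring
    rw [this]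
    have : Real.exp (t * (Q - M)) ≤ Real.exp (G * (Q - M)) :=
      Real.exp_le_exp.2 (by nlinarith)
    nlinarith [Real.exp_pos (t * M)]

theorem Cv_bound2 {K : ℕ} (hK : 0 < K) (hn : 0 < n) {τ t : ℝ} (hτ : 0 < τ)
    (hN : (n.choose K : ℝ) ≤ Real.exp (n * τ ^ 2)) (ht : 0 ≤ t) (htG : t ≤ τ * n / K)
    (v : Finset (Fin n)) (hv : v.card = K) :
    (n.choose K : ENNReal) * ∫⁻ g in Cv K 0 v, ENNReal.ofReal (Real.exp (t * Qf v g)) ∂(mu n)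
      ≤ ENNReal.ofReal (2 * Real.exp (t * (2 * K * τ))) := by
  classical
  have hK' : (0 : ℝ) < K := by exact_mod_cast hK
  have hn' : (0 : ℝ) < n := by exact_mod_cast hn
  set I := ∫⁻ g in Cv K 0 v, ENNReal.ofReal (Real.exp (t * Qf v g)) ∂(mu n) with hI
  set G := τ * n / K with hG
  set M := 2 * K * τ with hM
  set PS := Finset.powersetCard K (Finset.univ : Finset (Fin n)) with hPS
  have hcard : PS.card = n.choose K := by simp [hPS]
  have hmemPS : ∀ u, u ∈ PS ↔ u.card = K := by intro u; simp [hPS]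
  have h1 : (n.choose K : ENNReal) * I = ∑ u ∈ PS,
      ∫⁻ g in Cv K 0 u, ENNReal.ofReal (Real.exp (t * Qf u g)) ∂(mu n) := by
    rw [← hcard, ← nsmul_eq_mul, ← Finset.sum_const]
    apply Finset.sum_congr rfl
    intro u hu
    obtain ⟨σ, hσ⟩ := exists_perm_map (u := v) (v := u) (by rw [hv, (hmemPS u).1 hu])
    rw [← hσ, Cv_int_perm]
  have hmeas : ∀ u : Finset (Fin n), ∀ s : ℝ,
      Measurable fun g => ENNReal.ofReal (Real.exp (s * Qf u g)) := by
    intro u s; have := Qf_meas u; fun_prop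
  have hmeas' : ∀ u : Finset (Fin n), ∀ s r : ℝ,
      Measurable fun g => ENNReal.ofReal (Real.exp (s * (Qf u g - r))) := by
    intro u s r; have := Qf_meas u; fun_prop
  rw [h1]
  simp_rw [← lintegral_indicator (Cv_meas K 0 _)]
  rw [← lintegral_finsetSum _ (fun u _ => (hmeas u t).indicator (Cv_meas K 0 u))]
  calc _ ≤ ∫⁻ g, ENNReal.ofReal (Real.exp (t * M)) * (1 + ∑ u ∈ PS,
          ENNReal.ofReal (Real.exp (G * (Qf u g - M)))) ∂(mu n) := by
        refine lintegral_mono_ae ?_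
        filter_upwards [ae_no_tie hn] with g hg
        by_cases hex : ∃ w ∈ PS, g ∈ Cv K 0 w
        · obtain ⟨w, hw, hgw⟩ := hex
          rw [Finset.sum_eq_single_of_mem w hw]
          · rw [Set.indicator_of_mem hgw]
            calc ENNReal.ofReal (Real.exp (t * Qf w g))
                ≤ ENNReal.ofReal (Real.exp (t * M) * (1 + Real.exp (G * (Qf w g - M)))) :=
                  ENNReal.ofReal_le_ofReal (exp_trick ht htG)
              _ = ENNReal.ofReal (Real.exp (t * M)) *
                  (1 + ENNReal.ofReal (Real.exp (G * (Qf w g - M)))) := by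
                  rw [ENNReal.ofReal_mul (Real.exp_nonneg _),
                    ENNReal.ofReal_add zero_le_one (Real.exp_nonneg _), ENNReal.ofReal_one]
              _ ≤ _ := by
                  gcongr
                  exact Finset.single_le_sum
                    (f := fun u => ENNReal.ofReal (Real.exp (G * (Qf u g - M))))
                    (fun _ _ => zero_le) hw
          · intro u hu huw
            rw [Set.indicator_of_notMem]
            intro hgu
            have a1 := hgu w ((hmemPS w).1 hw)
            have a2 := hgw u ((hmemPS u).1 hu)
            simp only [Pi.zero_apply, Finset.sum_const_zero, add_zero] at a1 a2
            exact hg u w huw (le_antisymm a2 a1)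
        · push Not at hex
          rw [Finset.sum_eq_zero]
          · exact zero_le
          · intro u hu; rw [Set.indicator_of_notMem (hex u hu)]
    _ = ENNReal.ofReal (Real.exp (t * M)) * (1 + ∑ u ∈ PS,
          ∫⁻ g, ENNReal.ofReal (Real.exp (G * (Qf u g - M))) ∂(mu n)) := by
        rw [lintegral_const_mul, lintegral_add_left measurable_const,
          lintegral_finsetSum _ (fun u _ => hmeas' u G M)]
        · simp
        · exact measurable_const.add (Finset.measurable_sum _ (fun u _ => hmeas' u G M))
    _ ≤ ENNReal.ofReal (Real.exp (t * M)) * (1 + 1) := by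
        gcongr
        have : ∀ u ∈ PS, ∫⁻ g, ENNReal.ofReal (Real.exp (G * (Qf u g - M))) ∂(mu n)
            = ENNReal.ofReal (Real.exp (-(n * τ ^ 2))) := by
          intro u hu
          have hm := mgf_pi (vr n) (vr_ne hn) (fun p => G * coef u p)
          have e1 : ∀ g : Fin n × Fin n → ℝ, ∑ p, G * coef u p * g p = G * Qf u g := by
            intro g; rw [Qf_eq, Finset.mul_sum]; simp_rw [mul_assoc]
          have e2 : ∑ p, (G * coef u p) ^ 2 * (vr n p : ℝ) = G ^ 2 * (2 / n * (K : ℝ) ^ 2) := by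
            rw [← (hmemPS u).1 hu, ← coef_var, Finset.mul_sum]
            congr 1; ext p; ring
          simp_rw [e1, e2] at hm
          have e3 : ∀ g : Fin n × Fin n → ℝ, ENNReal.ofReal (Real.exp (G * (Qf u g - M))) =
              ENNReal.ofReal (Real.exp (-(G * M))) * ENNReal.ofReal (Real.exp (G * Qf u g)) := by
            intro g
            rw [← ENNReal.ofReal_mul (Real.exp_nonneg _), ← Real.exp_add]; congr 2; ring
          simp_rw [e3]
          rw [lintegral_const_mul _ (hmeas u G)]
          have hm' : ∫⁻ g, ENNReal.ofReal (Real.exp (G * Qf u g)) ∂(mu n) =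
            ENNReal.ofReal (Real.exp (G ^ 2 * (2 / n * (K : ℝ) ^ 2) / 2)) := hm
          rw [hm', ← ENNReal.ofReal_mul (Real.exp_nonneg _), ← Real.exp_add]
          congr 2
          rw [hG, hM]; field_simp; ring
        rw [Finset.sum_congr rfl this, Finset.sum_const, hcard, nsmul_eq_mul]
        rw [← ENNReal.ofReal_natCast, ← ENNReal.ofReal_mul (by positivity), ← ENNReal.ofReal_one]
        apply ENNReal.ofReal_le_ofReal
        rw [Real.exp_neg]
        rw [← div_eq_mul_inv, div_le_one (Real.exp_pos _)]
        exact hN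
    _ = _ := by
        rw [ENNReal.ofReal_mul (by norm_num), one_add_one_eq_two, mul_comm]
        simp

end upper

end part5

section part6
set_option linter.unusedSimpArgs false
set_option linter.unusedSectionVars false

variable {n : ℕ}

theorem card_count (x : Finset (Fin n)) (m K : ℕ) :
    (Finset.univ.filter fun v : Finset (Fin n) => v.card = K ∧ (v ∩ x).card = m).card ≤
      x.card.choose m * (n - m).choose (K - m) := by
  classical
  have h1 : (Finset.univ.filter fun v : Finset (Fin n) => v.card = K ∧ (v ∩ x).card = m) ⊆
      (Finset.powersetCard m x).biUnion fun B =>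
        (Finset.powersetCard (K - m) (Finset.univ \ B)).image fun D => B ∪ D := by
    intro v hv
    simp only [Finset.mem_filter, Finset.mem_univ, true_and] at hv
    simp only [Finset.mem_biUnion, Finset.mem_image, Finset.mem_powersetCard]
    refine ⟨v ∩ x, ⟨Finset.inter_subset_right, hv.2⟩, v \ (v ∩ x), ⟨?_, ?_⟩, ?_⟩
    · exact Finset.sdiff_subset_sdiff (Finset.subset_univ _) le_rfl
    · rw [Finset.card_sdiff_of_subset Finset.inter_subset_left, hv.1, hv.2]
    · exact Finset.union_sdiff_of_subset Finset.inter_subset_left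
  refine (Finset.card_le_card h1).trans (Finset.card_biUnion_le.trans ?_)
  refine (Finset.sum_le_card_nsmul _ _ ((n - m).choose (K - m)) ?_).trans ?_
  · intro B hB
    refine Finset.card_image_le.trans ?_
    rw [Finset.mem_powersetCard] at hB
    rw [Finset.card_powersetCard, Finset.card_sdiff_of_subset (Finset.subset_univ _), hB.2]
    simp
  · simp

theorem desc_ratio {K n : ℕ} (h : K ≤ n) (m : ℕ) :
    K.descFactorial m * n ^ m ≤ n.descFactorial m * K ^ m := by
  induction m with
  | zero => simp
  | succ m ih =>
    rw [Nat.descFactorial_succ, Nat.descFactorial_succ, pow_succ, pow_succ]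
    have : (K - m) * n ≤ (n - m) * K := by
      rw [Nat.sub_mul, Nat.sub_mul, mul_comm n K]
      have : m * K ≤ m * n := Nat.mul_le_mul_left _ h
      omega
    calc (K - m) * K.descFactorial m * (n ^ m * n) = (K.descFactorial m * n ^ m) * ((K - m) * n) := by ring
      _ ≤ (n.descFactorial m * K ^ m) * ((n - m) * K) := Nat.mul_le_mul ih this
      _ = _ := by ring

theorem choose_ratio {K n : ℕ} (h : K ≤ n) (m : ℕ) :
    K.choose m * n ^ m ≤ n.choose m * K ^ m := by
  have := desc_ratio h m
  rw [Nat.descFactorial_eq_factorial_mul_choose, Nat.descFactorial_eq_factorial_mul_choose,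
    mul_assoc, mul_assoc] at this
  exact Nat.le_of_mul_le_mul_left this (Nat.factorial_pos m)

theorem count_bound {k K n m : ℕ} (hn : 0 < n) (hK : K ≤ n) (hm : m ≤ K) (hm0 : 0 < m) :
    (k.choose m : ℝ) * ((n - m).choose (K - m) : ℝ) ≤
      (n.choose K : ℝ) * (Real.exp 1 * k * K / (n * m)) ^ m := by
  have e1 : (n.choose K : ℝ) * K.choose m = n.choose m * (n - m).choose (K - m) := by
    exact_mod_cast Nat.choose_mul (n := n) (k := K) (s := m) hm
  have e2 : (K.choose m : ℝ) * n ^ m ≤ n.choose m * K ^ m := by exact_mod_cast choose_ratio hK m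
  have e3 : (k.choose m : ℝ) ≤ k ^ m / m.factorial := Nat.choose_le_pow_div m k
  have e4 : (m : ℝ) ^ m / m.factorial ≤ Real.exp m := Real.pow_div_factorial_le_exp _ (by positivity) _
  have hn' : (0 : ℝ) < n := by exact_mod_cast hn
  have hm' : (0 : ℝ) < m := by exact_mod_cast hm0
  have hc : (0 : ℝ) < n.choose m := by exact_mod_cast Nat.choose_pos (hm.trans hK)
  have hmm : (0 : ℝ) < (m : ℝ) ^ m := by positivity
  have e5 : ((n - m).choose (K - m) : ℝ) ≤ n.choose K * (K / n) ^ m := by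
    rw [div_pow, mul_div_assoc', le_div_iff₀ (by positivity)]
    have : (n.choose m : ℝ) * (((n - m).choose (K - m) : ℝ) * n ^ m) ≤
        n.choose m * (n.choose K * K ^ m) := by
      rw [← mul_assoc, ← e1, mul_assoc, mul_left_comm (n.choose m : ℝ)]
      gcongr
    exact le_of_mul_le_mul_left this hc
  have e6 : (k.choose m : ℝ) ≤ (Real.exp 1 * k / m) ^ m := by
    refine e3.trans ?_
    rw [div_pow, mul_pow, ← Real.exp_nat_mul, mul_one, le_div_iff₀ hmm]
    calc (k : ℝ) ^ m / m.factorial * m ^ m = (m : ℝ) ^ m / m.factorial * k ^ m := by ring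
      _ ≤ _ := by gcongr
  calc _ ≤ (Real.exp 1 * k / m) ^ m * (n.choose K * (K / n) ^ m) := by gcongr
    _ = n.choose K * ((Real.exp 1 * k / m) * (K / n)) ^ m := by rw [mul_pow]; ring
    _ = _ := by congr 2; field_simp

theorem Cv_prob {K : ℕ} (hK : 0 < K) (hn : 0 < n) {τ : ℝ} (hτ : 0 < τ) (hKn : K ≤ n)
    (hN : (n.choose K : ℝ) ≤ Real.exp (n * τ ^ 2)) (x v : Finset (Fin n)) (hv : v.card = K) :
    mu n (Cv K (fun i => if i ∈ x then τ / 4 else 0) v) ≤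
      ENNReal.ofReal (2 * (Real.exp (n * τ ^ 2 / (4 * K))) ^ (v ∩ x).card / n.choose K) := by
  have hK' : (0 : ℝ) < K := by exact_mod_cast hK
  have hn' : (0 : ℝ) < n := by exact_mod_cast hn
  have hA : ∑ i ∈ v, (if i ∈ x then τ / 4 else 0) = τ / 4 * (v ∩ x).card := by
    rw [← Finset.sum_filter, Finset.filter_mem_eq_inter]; simp; ring
  have b1 := Cv_bound1 hK hn (fun i => if i ∈ x then τ / 4 else 0)
    (fun i => by split_ifs <;> positivity) v hv hA
  set t := τ / 4 * ((v ∩ x).card : ℝ) * n / (2 * (K : ℝ) ^ 2) with ht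
  have hmK : ((v ∩ x).card : ℝ) ≤ K := by
    rw [← hv]; exact_mod_cast Finset.card_le_card Finset.inter_subset_left
  have b2 := Cv_bound2 hK hn (t := t) hτ hN (by positivity) (by
    rw [ht, div_le_div_iff₀ (by positivity) hK']
    have : τ * ((v ∩ x).card : ℝ) * n * K ≤ τ * K * n * K := by gcongr
    nlinarith [mul_pos (mul_pos hτ hn') (mul_pos hK' hK')]) v hv
  have hc : (0 : ℝ) < n.choose K := by exact_mod_cast Nat.choose_pos hKn
  refine b1.trans ?_
  rw [ENNReal.ofReal_div_of_pos hc, ENNReal.ofReal_natCast,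
    ENNReal.le_div_iff_mul_le (Or.inl (by exact_mod_cast (Nat.choose_pos hKn).ne')) (Or.inl (by simp)),
    mul_comm]
  refine b2.trans (ENNReal.ofReal_le_ofReal ?_)
  rw [← Real.exp_nat_mul]
  apply le_of_eq
  congr 2
  rw [ht]; field_simp

theorem upper_lemma {K : ℕ} (hK : 0 < K) (hn : 0 < n) {τ ρ : ℝ} (hτ : 0 < τ) (hKn : K ≤ n)
    (hN : (n.choose K : ℝ) ≤ Real.exp (n * τ ^ 2)) (x : Finset (Fin n)) {m1 : ℕ} (hm1 : 0 < m1)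
    (hρ : Real.exp 1 * x.card * K / (n * m1) * Real.exp (n * τ ^ 2 / (4 * K)) ≤ ρ) (hρ2 : ρ ≤ 1 / 2) :
    mu n {g | ¬ ∀ S : Finset (Fin n), S.card = K → ∀ M, (∀ u : Finset (Fin n), u.card = K → Qf u g ≤ M) →
      Qf S g + τ / 4 * (x ∩ S).card ≤ M + τ / 4 * m1} ≤ ENNReal.ofReal (4 * ρ) := by
  classical
  have hK' : (0 : ℝ) < K := by exact_mod_cast hK
  have hn' : (0 : ℝ) < n := by exact_mod_cast hn
  have hm1' : (0 : ℝ) < m1 := by exact_mod_cast hm1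
  have hρ0 : 0 ≤ ρ := le_trans (by positivity) hρ
  have hc : (0 : ℝ) < n.choose K := by exact_mod_cast Nat.choose_pos hKn
  set y : Fin n → ℝ := fun i => if i ∈ x then τ / 4 else 0 with hy
  have hA : ∀ v : Finset (Fin n), ∑ i ∈ v, y i = τ / 4 * (x ∩ v).card := by
    intro v
    rw [hy, ← Finset.sum_filter, Finset.filter_mem_eq_inter, Finset.inter_comm]; simp; ring
  set B := Finset.univ.filter fun v : Finset (Fin n) => v.card = K ∧ m1 ≤ (v ∩ x).card with hB
  have hsub : {g | ¬ ∀ S : Finset (Fin n), S.card = K → ∀ M, (∀ u : Finset (Fin n), u.card = K → Qf u g ≤ M) →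
      Qf S g + τ / 4 * (x ∩ S).card ≤ M + τ / 4 * m1} ⊆ ⋃ v ∈ B, Cv K y v := by
    intro g hg
    by_contra hcon
    apply hg
    intro S hS M hM
    obtain ⟨v, hv, hmax⟩ := Finset.exists_max_image (Finset.powersetCard K Finset.univ)
      (fun u : Finset (Fin n) => Qf u g + ∑ i ∈ u, y i) ⟨S, by simp [hS]⟩
    have hvK : v.card = K := by simpa using hv
    have hvC : g ∈ Cv K y v := fun u hu => hmax u (by simp [hu])
    have hvB : (v ∩ x).card < m1 := by
      by_contra h
      apply hcon
      simp only [Set.mem_iUnion]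
      exact ⟨v, by simp [hB, hvK]; omega, hvC⟩
    have h1 := hvC S hS
    rw [hA, hA] at h1
    have h2 := hM v hvK
    have h3 : ((x ∩ v).card : ℝ) ≤ m1 := by rw [Finset.inter_comm]; exact_mod_cast hvB.le
    have h4 : τ / 4 * (x ∩ v).card ≤ τ / 4 * m1 := by gcongr
    linarith
  refine (measure_mono hsub).trans ((measure_biUnion_finset_le _ _).trans ?_)
  set E := Real.exp (n * τ ^ 2 / (4 * K)) with hE
  have hEp : 0 < E := Real.exp_pos _
  calc ∑ v ∈ B, mu n (Cv K y v)
      ≤ ∑ v ∈ B, ENNReal.ofReal (2 * E ^ (v ∩ x).card / n.choose K) := by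
        refine Finset.sum_le_sum fun v hv => Cv_prob hK hn hτ hKn hN x v ?_
        simp [hB] at hv; exact hv.1
    _ = ENNReal.ofReal (∑ v ∈ B, 2 * E ^ (v ∩ x).card / n.choose K) := by
        rw [ENNReal.ofReal_sum_of_nonneg]; intro v _; positivity
    _ ≤ ENNReal.ofReal (4 * ρ) := by
        apply ENNReal.ofReal_le_ofReal
        rw [← Finset.sum_fiberwise_of_maps_to (t := Finset.Icc m1 K) (g := fun v => (v ∩ x).card)]
        · calc _ ≤ ∑ m ∈ Finset.Icc m1 K, 2 * ρ ^ m := by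
                apply Finset.sum_le_sum
                intro m hm
                rw [Finset.mem_Icc] at hm
                have hm0 : (0 : ℝ) < m := by exact_mod_cast lt_of_lt_of_le hm1 hm.1
                have hmm : (m1 : ℝ) ≤ m := by exact_mod_cast hm.1
                calc _ = ∑ v ∈ B with (v ∩ x).card = m, 2 * E ^ m / n.choose K := by
                      apply Finset.sum_congr rfl
                      intro v hv
                      rw [Finset.mem_filter] at hv
                      rw [hv.2]
                  _ ≤ ((x.card.choose m : ℝ) * ((n - m).choose (K - m) : ℝ)) * (2 * E ^ m / n.choose K) := by
                      rw [Finset.sum_const, nsmul_eq_mul]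
                      gcongr
                      have : (B.filter fun v => (v ∩ x).card = m).card ≤
                          x.card.choose m * (n - m).choose (K - m) := by
                        refine (Finset.card_le_card ?_).trans (card_count x m K)
                        intro v hv
                        simp only [hB, Finset.mem_filter, Finset.mem_univ, true_and] at hv ⊢
                        exact ⟨hv.1.1, hv.2⟩
                      exact_mod_cast this
                  _ ≤ ((n.choose K : ℝ) * (Real.exp 1 * x.card * K / (n * m)) ^ m) * (2 * E ^ m / n.choose K) := by
                      refine mul_le_mul_of_nonneg_right ?_ (by positivity)
                      exact count_bound hn hKn hm.2 (by exact_mod_cast hm0)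
                  _ = 2 * (Real.exp 1 * x.card * K / (n * m) * E) ^ m := by
                      rw [mul_pow]; field_simp
                  _ ≤ 2 * ρ ^ m := by
                      gcongr
                      refine le_trans ?_ hρ
                      gcongr
            _ ≤ ∑ m ∈ Finset.Icc 1 K, 2 * ρ ^ m := by
                apply Finset.sum_le_sum_of_subset_of_nonneg
                · exact Finset.Icc_subset_Icc_left hm1
                · intros; positivity
            _ ≤ 4 * ρ := by
                have : ∀ K : ℕ, ∑ m ∈ Finset.Icc 1 K, 2 * ρ ^ m ≤ 4 * ρ - 4 * ρ ^ (K + 1) := by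
                  intro K
                  induction K with
                  | zero => simp
                  | succ K ih =>
                    rw [Finset.sum_Icc_succ_top (by omega)]
                    have : ρ ^ (K + 1 + 1) ≤ 1 / 2 * ρ ^ (K + 1) := by
                      rw [pow_succ, mul_comm]; gcongr
                    linarith
                have h := this K
                have : 0 ≤ ρ ^ (K + 1) := by positivity
                linarith
        · intro v hv
          simp only [hB, Finset.mem_filter, Finset.mem_univ, true_and] at hv
          rw [Finset.mem_Icc]
          exact ⟨hv.2, hv.1 ▸ Finset.card_le_card Finset.inter_subset_left⟩

end part6

section part7
set_option linter.unusedSimpArgs false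
set_option linter.unusedSectionVars false

variable {n : ℕ}

/-- event that all small quadratic forms are of typical size -/
def G1 (n K : ℕ) (τ : ℝ) : Set (Fin n × Fin n → ℝ) :=
  {g | ∀ b : Finset (Fin n), b.card ≤ K → |Qf b g| ≤ 4 * b.card * τ}

theorem G1_meas (K : ℕ) (τ : ℝ) : MeasurableSet (G1 n K τ) := by
  have : G1 n K τ = ⋂ b : Finset (Fin n), ⋂ _ : b.card ≤ K, {g | |Qf b g| ≤ 4 * b.card * τ} := by
    ext g; simp [G1]
  rw [this]
  refine MeasurableSet.iInter fun u => MeasurableSet.iInter fun _ => ?_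
  exact measurableSet_le (Qf_meas u).abs measurable_const

theorem Qf_empty (g : Fin n × Fin n → ℝ) : Qf ∅ g = 0 := by simp [Qf, quadForm]

theorem G1_prob (hn : 0 < n) {K : ℕ} {τ : ℝ} (hτ : 0 < τ)
    (hN : ((Finset.univ.filter fun b : Finset (Fin n) => b.card ≤ K).card : ℝ) ≤ Real.exp (n * τ ^ 2)) :
    mu n (G1 n K τ)ᶜ ≤ ENNReal.ofReal (2 * Real.exp (-(3 * n * τ ^ 2))) := by
  classical
  set B := Finset.univ.filter fun b : Finset (Fin n) => b.card ≤ K with hB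
  have hsub : (G1 n K τ)ᶜ ⊆ ⋃ b ∈ B.filter (fun b => 0 < b.card), {g | 4 * b.card * τ ≤ |Qf b g|} := by
    intro g hg
    simp only [G1, Set.mem_compl_iff, Set.mem_ofPred_eq, not_forall, not_le] at hg
    obtain ⟨b, hb, h⟩ := hg
    simp only [Set.mem_iUnion]
    refine ⟨b, ?_, h.le⟩
    simp only [hB, Finset.mem_filter, Finset.mem_univ, true_and]
    refine ⟨hb, ?_⟩
    rcases Finset.eq_empty_or_nonempty b with h0 | h0
    · subst h0; simp [Qf_empty] at h
    · exact Finset.card_pos.2 h0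
  refine (measure_mono hsub).trans ((measure_biUnion_finset_le _ _).trans ?_)
  have hb : ∀ b ∈ B.filter (fun b => 0 < b.card), mu n {g | 4 * b.card * τ ≤ |Qf b g|} ≤
      ENNReal.ofReal (2 * Real.exp (-(4 * n * τ ^ 2))) := by
    intro b hb
    have hb0 : 0 < b.card := (Finset.mem_filter.1 hb).2
    have hb0' : (0 : ℝ) < b.card := by exact_mod_cast hb0
    refine (Qf_tail hn b hb0 (s := 4 * b.card * τ) (by positivity)).trans ?_
    rw [ENNReal.ofReal_mul (by norm_num)]
    have : (2 : ENNReal) = ENNReal.ofReal 2 := by simp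
    rw [← this]
    gcongr
    apply le_of_eq
    field_simp
  refine (Finset.sum_le_card_nsmul _ _ _ hb).trans ?_
  rw [nsmul_eq_mul, ← ENNReal.ofReal_natCast, ← ENNReal.ofReal_mul (by positivity)]
  apply ENNReal.ofReal_le_ofReal
  calc _ ≤ Real.exp (n * τ ^ 2) * (2 * Real.exp (-(4 * n * τ ^ 2))) := by
        gcongr
        refine le_trans ?_ hN
        exact_mod_cast Finset.card_le_card (Finset.filter_subset _ _)
    _ = 2 * (Real.exp (n * τ ^ 2) * Real.exp (-(4 * n * τ ^ 2))) := by ring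
    _ = _ := by rw [← Real.exp_add]; congr 2; ring

/-- coordinate of `W v` -/
noncomputable def fv (v : Finset (Fin n)) (i : Fin n) (g : Fin n × Fin n → ℝ) : ℝ :=
  ∑ j ∈ v, symG g i j

theorem fv_meas (v : Finset (Fin n)) (i : Fin n) : Measurable (fv v i) := by
  unfold fv symG; fun_prop

theorem Qf_sdiff {v b : Finset (Fin n)} (h : b ⊆ v) (g : Fin n × Fin n → ℝ) :
    Qf (v \ b) g = Qf v g - 2 * ∑ i ∈ b, fv v i g + Qf b g := by
  have e1 : ∀ u : Finset (Fin n), ∀ i, ∑ j ∈ v, symG g i j = ∑ j ∈ v \ b, symG g i j + ∑ j ∈ b, symG g i j :=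
    fun u i => (Finset.sum_sdiff h).symm
  have e2 : Qf v g = ∑ i ∈ v \ b, (∑ j ∈ v \ b, symG g i j + ∑ j ∈ b, symG g i j) +
      ∑ i ∈ b, (∑ j ∈ v \ b, symG g i j + ∑ j ∈ b, symG g i j) := by
    unfold Qf quadForm
    rw [← Finset.sum_sdiff h]
    simp only [← e1 v]
  have e3 : ∑ i ∈ v \ b, ∑ j ∈ b, symG g i j = ∑ i ∈ b, ∑ j ∈ v \ b, symG g i j := by
    rw [Finset.sum_comm]
    exact Finset.sum_congr rfl fun i _ => Finset.sum_congr rfl fun j _ => symG_symm g j i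
  have e4 : ∑ i ∈ b, fv v i g = ∑ i ∈ b, (∑ j ∈ v \ b, symG g i j + ∑ j ∈ b, symG g i j) :=
    Finset.sum_congr rfl fun i _ => e1 v i
  rw [e2, e4]
  simp only [Finset.sum_add_distrib, e3]
  unfold Qf quadForm
  ring

theorem fv_sum {K : ℕ} {τ : ℝ} {g : Fin n × Fin n → ℝ} (hg : g ∈ G1 n K τ) {v : Finset (Fin n)}
    (hv : v.card = K) : ∑ i ∈ v, (max (fv v i g) 0 + τ) ≤ 5 * K * τ := by
  classical
  rw [Finset.sum_add_distrib]
  have h1 : ∑ i ∈ v, max (fv v i g) 0 = ∑ i ∈ v.filter (fun i => 0 ≤ fv v i g), fv v i g := by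
    rw [Finset.sum_filter]
    refine Finset.sum_congr rfl fun i _ => ?_
    split_ifs with h
    · exact max_eq_left h
    · exact max_eq_right (not_le.1 h).le
  set b := v.filter (fun i => 0 ≤ fv v i g) with hb
  have hbv : b ⊆ v := Finset.filter_subset _ _
  have h2 := Qf_sdiff hbv g
  have hc : (v \ b).card + b.card = v.card := Finset.card_sdiff_add_card_eq_card hbv
  have a1 := abs_le.1 (hg v hv.le)
  have a2 := abs_le.1 (hg b (by omega))
  have a3 := abs_le.1 (hg (v \ b) (by omega))
  have hc' : ((v \ b).card : ℝ) + b.card = K := by rw [← hv]; exact_mod_cast hc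
  have hc2 : ((v \ b).card : ℝ) * τ + b.card * τ = K * τ := by rw [← hc']; ring
  rw [h1]
  simp only [Finset.sum_const, nsmul_eq_mul, hv] at *
  linarith

theorem remove_lemma {K : ℕ} {τ : ℝ} {g : Fin n × Fin n → ℝ} (hg : g ∈ G1 n K τ)
    (r : ℕ) : ∀ b : Finset (Fin n), b.card ≤ K → r ≤ b.card →
      ∃ b' ⊆ b, b'.card + r = b.card ∧ Qf b g - 12 * r * τ ≤ Qf b' g := by
  classical
  induction r with
  | zero => intro b _ _; exact ⟨b, le_rfl, by simp, by simp⟩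
  | succ r ih =>
    intro b hb hr
    have hb0 : (0 : ℝ) < b.card := by exact_mod_cast (by omega : 0 < b.card)
    have hne : b.Nonempty := Finset.card_pos.1 (by omega)
    obtain ⟨i, hi, hle⟩ : ∃ i ∈ b, fv b i g ≤ Qf b g / b.card := by
      apply Finset.exists_le_of_sum_le hne
      rw [Finset.sum_const, nsmul_eq_mul, mul_div_cancel₀ _ hb0.ne']
      exact le_of_eq rfl
    have h2 := Qf_sdiff (Finset.singleton_subset_iff.2 hi) g
    have hcard : (b \ {i}).card + 1 = b.card := by
      have := Finset.card_sdiff_add_card_eq_card (Finset.singleton_subset_iff.2 hi)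
      simpa using this
    have a1 := abs_le.1 (hg {i} (by simp; omega))
    have a2 := abs_le.1 (hg b hb)
    have a3 : Qf b g / b.card ≤ 4 * τ := by
      rw [div_le_iff₀ hb0]; linarith [a2.2]
    obtain ⟨b', hb's, hb'c, hb'q⟩ := ih (b \ {i}) (by omega) (by omega)
    refine ⟨b', hb's.trans Finset.sdiff_subset, by omega, ?_⟩
    simp at a1 h2
    push_cast
    simp at hb'q
    linarith [a1.1]

end part7

section part8
set_option linter.unusedSimpArgs false
set_option linter.unusedSectionVars false

variable {n : ℕ}

theorem fv_permT (σ : Equiv.Perm (Fin n)) (g : Fin n × Fin n → ℝ) (v : Finset (Fin n)) (i : Fin n) :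
    fv v i (permT σ g) = fv (v.map σ.toEmbedding) (σ i) g := by
  simp [fv, symG_permT]

theorem G1_permT (σ : Equiv.Perm (Fin n)) (g : Fin n × Fin n → ℝ) (K : ℕ) (τ : ℝ) :
    permT σ g ∈ G1 n K τ ↔ g ∈ G1 n K τ := by
  constructor
  · intro h b hb
    have := h (b.map σ⁻¹.toEmbedding) (by simpa using hb)
    rw [Qf_permT] at this
    have e : (b.map σ⁻¹.toEmbedding).map σ.toEmbedding = b := by
      ext j; simp [Equiv.Perm.inv_def]
    rw [e] at this
    simpa using this
  · intro h b hb
    have := h (b.map σ.toEmbedding) (by simpa using hb)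
    rw [Qf_permT]
    simpa using this

open Classical in
noncomputable def phiI (K : ℕ) (τ : ℝ) (i : Fin n) (g : Fin n × Fin n → ℝ) : ENNReal :=
  ∑ v ∈ Finset.powersetCard K (Finset.univ : Finset (Fin n)),
    (G1 n K τ ∩ Cv K 0 v).indicator
      (fun g => if i ∈ v then ENNReal.ofReal (max (fv v i g) 0 + τ) else 0) g

theorem phiI_meas (K : ℕ) (τ : ℝ) (i : Fin n) : Measurable (phiI K τ i) := by
  unfold phiI
  refine Finset.measurable_sum _ fun v _ => ?_
  refine Measurable.indicator ?_ ((G1_meas K τ).inter (Cv_meas K 0 v))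
  split_ifs
  · exact (((fv_meas v i).max measurable_const).add measurable_const).ennreal_ofReal
  · exact measurable_const

theorem phiI_perm (K : ℕ) (τ : ℝ) (i : Fin n) (σ : Equiv.Perm (Fin n)) (g : Fin n × Fin n → ℝ) :
    phiI K τ i (permT σ g) = phiI K τ (σ i) g := by
  classical
  unfold phiI
  refine Finset.sum_bij' (fun v _ => v.map σ.toEmbedding) (fun v _ => v.map σ⁻¹.toEmbedding) ?_ ?_ ?_ ?_ ?_
  · intro v hv; simpa using hv
  · intro v hv; simpa using hv
  · intro v _; ext j; simp [Equiv.Perm.inv_def]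
  · intro v _; ext j; simp [Equiv.Perm.inv_def]
  · intro v _
    have h1 : permT σ g ∈ G1 n K τ ∩ Cv K 0 v ↔ g ∈ G1 n K τ ∩ Cv K 0 (v.map σ.toEmbedding) := by
      have h := Cv_perm K 0 v σ
      rw [Set.mem_inter_iff, Set.mem_inter_iff, G1_permT, ← h]
      rfl
    by_cases h : g ∈ G1 n K τ ∩ Cv K 0 (v.map σ.toEmbedding)
    · rw [Set.indicator_of_mem h, Set.indicator_of_mem (h1.2 h), fv_permT]
      simp
    · rw [Set.indicator_of_notMem h, Set.indicator_of_notMem (fun hh => h (h1.1 hh))]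

theorem phiI_int (K : ℕ) (τ : ℝ) (i j : Fin n) :
    ∫⁻ g, phiI K τ i g ∂(mu n) = ∫⁻ g, phiI K τ j g ∂(mu n) := by
  have h := (permT_mp (Equiv.swap i j)).lintegral_comp (phiI_meas K τ i)
  simp only [phiI_perm, Equiv.swap_apply_left] at h
  exact h.symm

theorem Cv_unique {K : ℕ} {u w : Finset (Fin n)} {g : Fin n × Fin n → ℝ}
    (hg : ∀ u w : Finset (Fin n), u ≠ w → Qf u g ≠ Qf w g) (hu : u.card = K) (hw : w.card = K)
    (hgu : g ∈ Cv K 0 u) (hgw : g ∈ Cv K 0 w) : u = w := by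
  by_contra huw
  have a1 := hgu w hw
  have a2 := hgw u hu
  simp only [Pi.zero_apply, Finset.sum_const_zero, add_zero] at a1 a2
  exact hg u w huw (le_antisymm a2 a1)

theorem phiI_sum (hn : 0 < n) {K : ℕ} {τ : ℝ} (hτ : 0 < τ) :
    ∑ i, ∫⁻ g, phiI K τ i g ∂(mu n) ≤ ENNReal.ofReal (5 * K * τ) := by
  classical
  rw [← lintegral_finsetSum _ (fun i _ => phiI_meas K τ i)]
  have : ∫⁻ _, ENNReal.ofReal (5 * K * τ) ∂(mu n) = ENNReal.ofReal (5 * K * τ) := by simp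
  rw [← this]
  refine lintegral_mono_ae ?_
  filter_upwards [ae_no_tie hn] with g hg
  unfold phiI
  rw [Finset.sum_comm]
  by_cases hex : ∃ w ∈ Finset.powersetCard K (Finset.univ : Finset (Fin n)), g ∈ G1 n K τ ∩ Cv K 0 w
  · obtain ⟨w, hw, hgw⟩ := hex
    have hwK : w.card = K := by simpa using hw
    rw [Finset.sum_eq_single_of_mem w hw]
    · simp only [Set.indicator_of_mem hgw]
      rw [← Finset.sum_filter]
      rw [← ENNReal.ofReal_sum_of_nonneg]
      · apply ENNReal.ofReal_le_ofReal
        have := fv_sum hgw.1 hwK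
        simpa using this
      · intro i _; positivity
    · intro u hu huw
      refine Finset.sum_eq_zero fun i _ => ?_
      rw [Set.indicator_of_notMem]
      intro hgu
      exact huw (Cv_unique hg (by simpa using hu) hwK hgu.2 hgw.2)
  · push Not at hex
    rw [Finset.sum_eq_zero]
    · exact zero_le
    · intro u hu
      refine Finset.sum_eq_zero fun i _ => ?_
      rw [Set.indicator_of_notMem (hex u hu)]

theorem phiI_one (hn : 0 < n) {K : ℕ} {τ : ℝ} (hτ : 0 < τ) (i : Fin n) :
    ∫⁻ g, phiI K τ i g ∂(mu n) ≤ ENNReal.ofReal (5 * K * τ / n) := by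
  have h := phiI_sum hn (K := K) hτ
  rw [Finset.sum_congr rfl (fun j _ => phiI_int K τ j i), Finset.sum_const] at h
  have hn' : (0 : ℝ) < n := by exact_mod_cast hn
  rw [ENNReal.ofReal_div_of_pos hn', ENNReal.ofReal_natCast,
    ENNReal.le_div_iff_mul_le (Or.inl (by exact_mod_cast hn.ne')) (Or.inl (by simp)), mul_comm]
  simpa using h

theorem markov_lemma (hn : 0 < n) {K : ℕ} {τ t : ℝ} (hτ : 0 < τ) (ht : 0 < t) (X : Finset (Fin n)) :
    mu n {g | ∃ v : Finset (Fin n), v.card = K ∧ g ∈ G1 n K τ ∩ Cv K 0 v ∧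
      t ≤ ∑ i ∈ v ∩ X, (max (fv v i g) 0 + τ)} ≤ ENNReal.ofReal (5 * K * X.card * τ / (n * t)) := by
  classical
  have hn' : (0 : ℝ) < n := by exact_mod_cast hn
  have hm : Measurable fun g => ∑ i ∈ X, phiI (n := n) K τ i g :=
    Finset.measurable_sum _ fun i _ => phiI_meas K τ i
  have h := mul_meas_ge_le_lintegral (μ := mu n) hm (ENNReal.ofReal t)
  have h2 : ∫⁻ g, ∑ i ∈ X, phiI K τ i g ∂(mu n) ≤ ENNReal.ofReal (X.card * (5 * K * τ / n)) := by
    rw [lintegral_finsetSum _ (fun i _ => phiI_meas K τ i)]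
    refine (Finset.sum_le_card_nsmul _ _ _ fun i _ => phiI_one hn hτ i).trans ?_
    rw [nsmul_eq_mul, ENNReal.ofReal_mul (by positivity), ENNReal.ofReal_natCast]
  have h3 : mu n {g | ENNReal.ofReal t ≤ ∑ i ∈ X, phiI K τ i g} ≤
      ENNReal.ofReal (5 * K * X.card * τ / (n * t)) := by
    have e : 5 * K * X.card * τ / (n * t) = (X.card * (5 * K * τ / n)) / t := by field_simp
    rw [e, ENNReal.ofReal_div_of_pos ht, ENNReal.le_div_iff_mul_le (Or.inl (by simpa using ht)) (Or.inl (by simp)),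
      mul_comm]
    exact h.trans h2
  refine (measure_mono ?_).trans h3
  rintro g ⟨v, hv, hg, hle⟩
  refine (ENNReal.ofReal_le_ofReal hle).trans ?_
  rw [ENNReal.ofReal_sum_of_nonneg (fun i _ => by positivity)]
  rw [Finset.inter_comm, ← Finset.filter_mem_eq_inter, Finset.sum_filter]
  refine Finset.sum_le_sum fun i _ => ?_
  unfold phiI
  have : (if i ∈ v then ENNReal.ofReal (max (fv v i g) 0 + τ) else 0) =
    (G1 n K τ ∩ Cv K 0 v).indicator
      (fun g => if i ∈ v then ENNReal.ofReal (max (fv v i g) 0 + τ) else 0) g := by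
    rw [Set.indicator_of_mem hg]
  rw [this]
  exact Finset.single_le_sum (f := fun v => (G1 n K τ ∩ Cv K 0 v).indicator
      (fun g => if i ∈ v then ENNReal.ofReal (max (fv v i g) 0 + τ) else 0) g) (fun _ _ => zero_le)
      (by simpa using hv)

/-- maximizer among `K`-sets avoiding `X` -/
def Dv (K : ℕ) (X c : Finset (Fin n)) : Set (Fin n × Fin n → ℝ) :=
  {g | ∀ d : Finset (Fin n), d.card = K → Disjoint d X → Qf d g ≤ Qf c g}

theorem Dv_meas (K : ℕ) (X c : Finset (Fin n)) : MeasurableSet (Dv K X c) := by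
  have : Dv K X c = ⋂ u : Finset (Fin n), ⋂ _ : u.card = K, ⋂ _ : Disjoint u X,
      {g | Qf u g ≤ Qf c g} := by
    ext g; simp [Dv]
  rw [this]
  refine MeasurableSet.iInter fun u => MeasurableSet.iInter fun _ => MeasurableSet.iInter fun _ => ?_
  exact measurableSet_le (Qf_meas u) (Qf_meas c)

theorem Dv_sum (hn : 0 < n) (K : ℕ) (X : Finset (Fin n)) :
    ∑ c ∈ (Finset.powersetCard K (Finset.univ : Finset (Fin n))).filter (fun c => Disjoint c X),
      mu n (Dv K X c) ≤ 1 := by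
  classical
  have : ∫⁻ _, 1 ∂(mu n) = 1 := by simp
  rw [← this]
  simp_rw [← lintegral_indicator_one (Dv_meas K X _)]
  rw [← lintegral_finsetSum _ (fun c _ => measurable_one.indicator (Dv_meas K X c))]
  refine lintegral_mono_ae ?_
  filter_upwards [ae_no_tie hn] with g hg
  set PS := (Finset.powersetCard K (Finset.univ : Finset (Fin n))).filter (fun c => Disjoint c X) with hPS
  have hmem : ∀ c, c ∈ PS ↔ c.card = K ∧ Disjoint c X := by intro c; simp [hPS]
  by_cases hex : ∃ w ∈ PS, g ∈ Dv K X w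
  · obtain ⟨w, hw, hgw⟩ := hex
    rw [Finset.sum_eq_single_of_mem w hw]
    · simp [Set.indicator_of_mem hgw]
    · intro u hu huw
      rw [Set.indicator_of_notMem]
      intro hgu
      rw [hmem] at hu hw
      exact hg u w huw (le_antisymm (hgw u hu.1 hu.2) (hgu w hw.1 hw.2))
  · push Not at hex
    rw [Finset.sum_eq_zero]
    · exact zero_le
    · intro u hu; rw [Set.indicator_of_notMem (hex u hu)]

theorem add_lemma (hn : 0 < n) {K m : ℕ} (hm : m ≤ K) (hm0 : 0 < m) {t : ℝ} (ht : 0 < t)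
    {A X : Finset (Fin n)} (hAX : A ⊆ X) (hA : A.card = m) :
    mu n {g | ∃ c : Finset (Fin n), c.card = K - m ∧ Disjoint c X ∧ g ∈ Dv (K - m) X c ∧
      t ≤ Qf c g - Qf (c ∪ A) g} ≤ ENNReal.ofReal (Real.exp (-(t ^ 2 * n) / (8 * m * K))) := by
  classical
  have hn' : (0 : ℝ) < n := by exact_mod_cast hn
  have hm' : (0 : ℝ) < m := by exact_mod_cast hm0
  have hmK : (m : ℝ) ≤ K := by exact_mod_cast hm
  have hK' : (0 : ℝ) < K := by linarith
  set PS := (Finset.powersetCard (K - m) (Finset.univ : Finset (Fin n))).filter (fun c => Disjoint c X) with hPS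
  have hmem : ∀ c, c ∈ PS ↔ c.card = K - m ∧ Disjoint c X := by intro c; simp [hPS]
  have hsub : {g | ∃ c : Finset (Fin n), c.card = K - m ∧ Disjoint c X ∧ g ∈ Dv (K - m) X c ∧
      t ≤ Qf c g - Qf (c ∪ A) g} ⊆ ⋃ c ∈ PS, (Dv (K - m) X c ∩ {g | t ≤ Qf c g - Qf (c ∪ A) g}) := by
    rintro g ⟨c, h1, h2, h3, h4⟩
    simp only [Set.mem_iUnion]
    exact ⟨c, (hmem c).2 ⟨h1, h2⟩, h3, h4⟩
  refine (measure_mono hsub).trans ((measure_biUnion_finset_le _ _).trans ?_)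
  have key : ∀ c ∈ PS, mu n (Dv (K - m) X c ∩ {g | t ≤ Qf c g - Qf (c ∪ A) g}) ≤
      ENNReal.ofReal (Real.exp (-(t ^ 2 * n) / (8 * m * K))) * mu n (Dv (K - m) X c) := by
    intro c hc
    rw [hmem] at hc
    have hdA : ∀ d : Finset (Fin n), Disjoint d X → d ∩ (c ∪ A) = d ∩ c := by
      intro d hd
      rw [Finset.inter_union_distrib_left, Finset.disjoint_iff_inter_eq_empty.1 (hd.mono_right hAX),
        Finset.union_empty]
    have h := tail_pi_inv (vr n) (vr_ne hn) (fun p => coef c p - coef (c ∪ A) p) (Dv (K - m) X c)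
      (Dv_meas _ _ _) (V := 4 * m * K / n) (s := t) (by
        intro g t
        have e : (fun i => g i + t * (coef c i - coef (c ∪ A) i) * (vr n i : ℝ)) =
          fun p => g p + (t * coef c p - t * coef (c ∪ A) p) * vr n p := by
            ext p; ring
        rw [e]
        have inv : ∀ d : Finset (Fin n), Disjoint d X →
            Qf d (fun p => g p + (t * coef c p - t * coef (c ∪ A) p) * vr n p) = Qf d g := by
          intro d hd
          rw [Qf_shift, hdA d hd]; ring
        constructor
        · intro h d hd hdX
          have := h d hd hdX
          rwa [inv d hdX, inv c hc.2] at this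
        · intro h d hd hdX
          have := h d hd hdX
          rwa [inv d hdX, inv c hc.2]) (by
        rw [coef_diff_var]
        have e1 : (c ∪ A).card = K := by
          rw [Finset.card_union_of_disjoint (hc.2.mono_right hAX), hc.1, hA]; omega
        have e2 : c ∩ (c ∪ A) = c := Finset.inter_eq_left.2 Finset.subset_union_left
        rw [e1, e2, hc.1, Nat.cast_sub hm]
        rw [div_mul_eq_mul_div]
        refine div_le_div_of_nonneg_right ?_ hn'.le
        nlinarith) (by positivity) ht.le
    have e : -(t ^ 2) / (2 * (4 * m * K / n)) = -(t ^ 2 * n) / (8 * m * K) := by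
      field_simp; ring
    rw [e] at h
    refine le_trans (le_of_eq ?_) h
    unfold mu
    congr 2
    ext g
    simp only [Set.mem_ofPred_eq, sub_mul, Finset.sum_sub_distrib, ← Qf_eq]
  refine (Finset.sum_le_sum key).trans ?_
  rw [← Finset.mul_sum]
  calc _ ≤ ENNReal.ofReal (Real.exp (-(t ^ 2 * n) / (8 * m * K))) * 1 := by
        gcongr
        exact Dv_sum hn (K - m) X
    _ = _ := mul_one _

theorem lower_lemma (hn : 0 < n) {K m : ℕ} (hKn : K ≤ n) (hm : m ≤ K) (hm0 : 0 < m) {τ t : ℝ} (hτ : 0 < τ)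
    (hN : ((Finset.univ.filter fun b : Finset (Fin n) => b.card ≤ K).card : ℝ) ≤ Real.exp (n * τ ^ 2))
    (ht : 0 < t) (htm : t ≤ m * τ)
    {A X : Finset (Fin n)} (hAX : A ⊆ X) (hA : A.card = m) :
    mu n {g | ¬ ∃ S : Finset (Fin n), S.card = K ∧ S ∩ X = A ∧
      ∀ u : Finset (Fin n), u.card = K → Qf u g - 12 * m * τ - 5 * t ≤ Qf S g} ≤
      ENNReal.ofReal (2 * Real.exp (-(3 * n * τ ^ 2)) + 5 * K * X.card * τ / (n * t) +
        Real.exp (-(t ^ 2 * n) / (8 * m * K))) := by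
  classical
  have hn' : (0 : ℝ) < n := by exact_mod_cast hn
  rw [ENNReal.ofReal_add (by positivity) (by positivity), ENNReal.ofReal_add (by positivity) (by positivity)]
  refine le_trans ?_ (add_le_add (add_le_add (G1_prob hn hτ hN) (markov_lemma hn (K := K) hτ ht X))
    (add_lemma hn hm hm0 ht hAX hA))
  refine le_trans (measure_mono ?_) ((measure_union_le _ _).trans (add_le_add_left (measure_union_le _ _) _))
  intro g hg
  by_contra hcon
  simp only [Set.mem_union, not_or, Set.mem_compl_iff, not_not, Set.mem_ofPred_eq, not_exists, not_and, not_le] at hcon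
  obtain ⟨⟨h1, h2⟩, h3⟩ := hcon
  apply hg
  obtain ⟨v, hv, hmax⟩ := Finset.exists_max_image (Finset.powersetCard K Finset.univ)
      (fun u : Finset (Fin n) => Qf u g) (by
        apply Finset.powersetCard_nonempty.2; simpa using hKn)
  have hvK : v.card = K := by simpa using hv
  have hvC : g ∈ Cv K 0 v := fun u hu => by simpa using hmax u (by simp [hu])
  have h2' := h2 v hvK ⟨h1, hvC⟩
  rw [Finset.sum_add_distrib, Finset.sum_const, nsmul_eq_mul] at h2'
  set a := v ∩ X with ha
  have hav : a ⊆ v := Finset.inter_subset_left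
  have hF : ∑ i ∈ a, fv v i g ≤ ∑ i ∈ a, max (fv v i g) 0 :=
    Finset.sum_le_sum fun i _ => le_max_left _ _
  have hF0 : 0 ≤ ∑ i ∈ a, max (fv v i g) 0 := Finset.sum_nonneg fun i _ => le_max_right _ _
  have hqm : a.card ≤ m := by
    have : (a.card : ℝ) * τ < m * τ := by linarith
    have := lt_of_mul_lt_mul_right this hτ.le
    exact_mod_cast this.le
  have hsd := Qf_sdiff hav g
  have hcard : (v \ a).card + a.card = v.card := Finset.card_sdiff_add_card_eq_card hav
  have haQ := abs_le.1 (h1 a (by omega))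
  obtain ⟨b', hb's, hb'c, hb'q⟩ := remove_lemma h1 (m - a.card) (v \ a) (by omega) (by omega)
  have hb'K : b'.card = K - m := by omega
  have hb'X : Disjoint b' X := by
    refine Finset.disjoint_of_subset_left hb's ?_
    rw [ha, Finset.disjoint_left]
    intro i hi hiX
    simp at hi; exact hi.2 hiX
  obtain ⟨c, hc, hcmax⟩ := Finset.exists_max_image
    ((Finset.powersetCard (K - m) (Finset.univ : Finset (Fin n))).filter (fun c => Disjoint c X))
      (fun u : Finset (Fin n) => Qf u g) ⟨b', by simp [hb'K, hb'X]⟩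
  have hcK : c.card = K - m ∧ Disjoint c X := by simpa using hc
  have hcD : g ∈ Dv (K - m) X c := fun d hd hdX => hcmax d (by simp [hd, hdX])
  have h3' := h3 c hcK.1 hcK.2 hcD
  refine ⟨c ∪ A, ?_, ?_, ?_⟩
  · rw [Finset.card_union_of_disjoint (hcK.2.mono_right hAX), hcK.1, hA]; omega
  · rw [Finset.union_inter_distrib_right, Finset.disjoint_iff_inter_eq_empty.1 hcK.2,
      Finset.empty_union, Finset.inter_eq_left.2 hAX]
  · intro u hu
    have e1 := hmax u (by simp [hu])
    have e2 := hcD b' hb'K hb'X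
    rw [Nat.cast_sub hqm] at hb'q
    have : 0 ≤ (a.card : ℝ) * τ := by positivity
    have e3 := haQ.1
    nlinarith

end part8

section part9
set_option linter.unusedSimpArgs false
set_option linter.unusedSectionVars false

variable {n : ℕ}

theorem quad_Ymat (k : ℕ) (lam : ℝ) (x S : Finset (Fin n)) (W : Fin n → Fin n → ℝ) :
    quadForm (Ymat k lam x W) S = lam / k * ((x ∩ S).card : ℝ) ^ 2 + quadForm W S := by
  unfold quadForm Ymat
  simp only [Finset.sum_add_distrib, ← Finset.mul_sum]
  congr 2
  rw [← Finset.sum_mul]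
  have : ∑ i ∈ S, (if i ∈ x then (1 : ℝ) else 0) = (x ∩ S).card := by
    rw [← Finset.sum_filter, Finset.filter_mem_eq_inter, Finset.inter_comm]; simp
  rw [this, sq]

theorem phi_finite (K m : ℕ) (Y : Fin n → Fin n → ℝ) (x : Finset (Fin n)) :
    {r : ℝ | ∃ S : Finset (Fin n), S.card = K ∧ (x ∩ S).card = m ∧ r = -quadForm Y S}.Finite := by
  refine (Set.finite_range fun S : Finset (Fin n) => -quadForm Y S).subset ?_
  rintro r ⟨S, _, _, h⟩
  exact ⟨S, h.symm⟩

theorem phi_le {K m : ℕ} {Y : Fin n → Fin n → ℝ} {x S : Finset (Fin n)} (h1 : S.card = K)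
    (h2 : (x ∩ S).card = m) : phiVal K m Y x ≤ -quadForm Y S :=
  csInf_le (phi_finite K m Y x).bddBelow ⟨S, h1, h2, rfl⟩

theorem phi_attained {K m : ℕ} {Y : Fin n → Fin n → ℝ} {x : Finset (Fin n)}
    (h : ∃ S : Finset (Fin n), S.card = K ∧ (x ∩ S).card = m) :
    ∃ S : Finset (Fin n), S.card = K ∧ (x ∩ S).card = m ∧ phiVal K m Y x = -quadForm Y S := by
  obtain ⟨S, h1, h2⟩ := h
  have hne : {r : ℝ | ∃ S : Finset (Fin n), S.card = K ∧ (x ∩ S).card = m ∧ r = -quadForm Y S}.Nonempty :=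
    ⟨_, S, h1, h2, rfl⟩
  exact hne.csInf_mem (phi_finite K m Y x)

theorem exists_set {x : Finset (Fin n)} {m K : ℕ} (h1 : m ≤ x.card) (h2 : m ≤ K) (h3 : x.card + K ≤ n) :
    ∃ S : Finset (Fin n), S.card = K ∧ (x ∩ S).card = m := by
  classical
  obtain ⟨a, ha, hac⟩ := Finset.exists_subset_card_eq h1
  obtain ⟨b, hb, hbc⟩ := Finset.exists_subset_card_eq (s := (Finset.univ \ x : Finset (Fin n))) (n := K - m) (by
    rw [Finset.card_sdiff_of_subset (Finset.subset_univ _)]; simp; omega)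
  have hd : Disjoint b x := Finset.disjoint_of_subset_left hb Finset.sdiff_disjoint
  refine ⟨a ∪ b, ?_, ?_⟩
  · rw [Finset.card_union_of_disjoint (hd.mono_right ha).symm, hac, hbc]; omega
  · rw [Finset.inter_union_distrib_left, Finset.disjoint_iff_inter_eq_empty.1 hd.symm, Finset.union_empty,
      Finset.inter_eq_right.2 ha, hac]

/-- The good event for the noise. -/
def Good (K ℓ m0 : ℕ) (τ : ℝ) (x : Finset (Fin n)) : Set (Fin n × Fin n → ℝ) :=
  {g | (∀ S : Finset (Fin n), S.card = K → ∀ M, (∀ u : Finset (Fin n), u.card = K → Qf u g ≤ M) →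
      Qf S g + τ / 4 * (x ∩ S).card ≤ M + τ / 4 * ((ℓ / 12 + 1 : ℕ) : ℝ)) ∧
    (∃ S : Finset (Fin n), S.card = K ∧ (x ∩ S).card = m0 ∧ ∀ u : Finset (Fin n), u.card = K →
      Qf u g - 12 * ((ℓ / 2000 + 1 : ℕ) : ℝ) * τ - 5 * (ℓ * τ / 2000) ≤ Qf S g) ∧
    (∃ S : Finset (Fin n), S.card = K ∧ (x ∩ S).card = 400 * ℓ ∧ ∀ u : Finset (Fin n), u.card = K →
      Qf u g - 12 * ((400 * ℓ : ℕ) : ℝ) * τ - 5 * (ℓ * τ / 2000) ≤ Qf S g)}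

theorem Good_gap {k K ℓ m0 : ℕ} {τ lam : ℝ} (hτ : 0 < τ) {x : Finset (Fin n)}
    (hk : 0 < k) (hKn : K ≤ n) (hlam : 0 < lam) (hxk : x.card = k)
    (hℓ : 2000 ≤ ℓ) (hℓk : 400 * ℓ ≤ k) (hℓK : 400 * ℓ ≤ K) (hkK : k + K ≤ n)
    (h1 : lam * ℓ / k ≤ τ / 16) (h2 : τ / 32 ≤ lam * ℓ / k) {D : ℝ} (hD : D ≤ ℓ * τ / 100)
    {g : Fin n × Fin n → ℝ} (hg : g ∈ Good K ℓ m0 τ x) (ℓ' : ℕ)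
    (hl1 : (ℓ : ℝ) / 3 < (ℓ' : ℝ)) (hl2 : (ℓ' : ℝ) < (ℓ : ℝ) / 2) :
    max (phiVal K m0 (Ymat k lam x (symG g)) x) (phiVal K (400 * ℓ) (Ymat k lam x (symG g)) x) + D ≤
      phiVal K ℓ' (Ymat k lam x (symG g)) x := by
  classical
  obtain ⟨ga, ⟨S0, hS0, hS0x, gb⟩, ⟨SC, hSC, hSCx, gc⟩⟩ := hg
  have hk' : (0 : ℝ) < k := by exact_mod_cast hk
  have hℓ'R : (2000 : ℝ) ≤ ℓ := by exact_mod_cast hℓ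
  have hl2' : ℓ' ≤ ℓ := by
    have : (ℓ' : ℝ) ≤ ℓ := by linarith
    exact_mod_cast this
  obtain ⟨S, hS, hSx, hphi⟩ := phi_attained (Y := Ymat k lam x (symG g))
    (exists_set (x := x) (m := ℓ') (K := K) (by omega) (by omega) (by omega))
  obtain ⟨v, hv, hmax⟩ := Finset.exists_max_image (Finset.powersetCard K Finset.univ)
      (fun u : Finset (Fin n) => Qf u g) (by
        apply Finset.powersetCard_nonempty.2; simpa using hKn)
  have hvK : v.card = K := by simpa using hv
  have A1 := ga S hS (Qf v g) (fun u hu => hmax u (by simp [hu]))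
  have A2 := gb v hvK
  have A3 := gc v hvK
  have P0 := phi_le (Y := Ymat k lam x (symG g)) hS0 hS0x
  have PC := phi_le (Y := Ymat k lam x (symG g)) hSC hSCx
  rw [hphi]
  rw [quad_Ymat, hS0x] at P0
  rw [quad_Ymat, hSCx] at PC
  rw [quad_Ymat, hSx]
  rw [hSx] at A1
  change _ ≤ -(_ + Qf S0 g) at P0
  change _ ≤ -(_ + Qf SC g) at PC
  change _ ≤ -(_ + Qf S g)
  have m1b : ((ℓ / 12 + 1 : ℕ) : ℝ) ≤ ℓ / 10 := by
    have : (ℓ / 12 + 1) * 10 ≤ ℓ := by omega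
    have : (((ℓ / 12 + 1 : ℕ) : ℝ)) * 10 ≤ ℓ := by exact_mod_cast this
    linarith
  have m2b : ((ℓ / 2000 + 1 : ℕ) : ℝ) ≤ ℓ / 1000 := by
    have : (ℓ / 2000 + 1) * 1000 ≤ ℓ := by omega
    have : (((ℓ / 2000 + 1 : ℕ) : ℝ)) * 1000 ≤ ℓ := by exact_mod_cast this
    linarith
  have m1c := mul_le_mul_of_nonneg_right m1b hτ.le
  have m2c := mul_le_mul_of_nonneg_right m2b hτ.le
  have hlt : 0 < ℓ * τ := by positivity
  have q1 : lam / k * (ℓ' : ℝ) ^ 2 ≤ ℓ * τ / 64 := by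
    calc lam / k * (ℓ' : ℝ) ^ 2 ≤ lam / k * ((ℓ : ℝ) / 2) ^ 2 := by gcongr
      _ = lam * ℓ / k * (ℓ / 4) := by ring
      _ ≤ τ / 16 * (ℓ / 4) := by gcongr
      _ = _ := by ring
  have q2 : 5000 * (ℓ * τ) ≤ lam / k * ((400 * ℓ : ℕ) : ℝ) ^ 2 := by
    calc 5000 * (ℓ * τ) = τ / 32 * (160000 * ℓ) := by ring
      _ ≤ lam * ℓ / k * (160000 * ℓ) := by gcongr
      _ = _ := by push_cast; ring
  have q3 : 0 ≤ lam / k * (m0 : ℝ) ^ 2 := by positivity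
  have q4 : (ℓ * τ) / 3 ≤ τ * ℓ' := by nlinarith
  push_cast at A3 q2
  rw [← le_sub_iff_add_le, max_le_iff]
  push_cast at m1c m2c A1 A2
  push_cast at PC
  constructor
  · linarith
  · linarith

theorem gap_ogp {k K ℓ m0 : ℕ} {x : Finset (Fin n)} {Y : Fin n → Fin n → ℝ}
    (hℓ : 2000 ≤ ℓ) (hℓk : 400 * ℓ ≤ k) (hℓK : 400 * ℓ ≤ K) (hm0 : m0 ≤ ℓ / 3)
    (hkK : k + K ≤ n) (hxk : x.card = k) {D : ℝ} (hD : 0 < D)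
    (hgap : ∀ ℓ' : ℕ, (ℓ : ℝ) / 3 < (ℓ' : ℝ) → (ℓ' : ℝ) < (ℓ : ℝ) / 2 →
      max (phiVal K m0 Y x) (phiVal K (400 * ℓ) Y x) + D ≤ phiVal K ℓ' Y x) :
    hasOGP k K Y x (ℓ / 3) ((ℓ + 1) / 2) := by
  refine ⟨by omega, by omega, by omega, max (phiVal K m0 Y x) (phiVal K (400 * ℓ) Y x), ?_, ?_⟩
  · obtain ⟨v, hv, hvx, hphi⟩ := phi_attained (Y := Y)
      (exists_set (x := x) (m := m0) (K := K) (by omega) (by omega) (by omega))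
    obtain ⟨w, hw, hwx, hphiw⟩ := phi_attained (Y := Y)
      (exists_set (x := x) (m := 400 * ℓ) (K := K) (by omega) (by omega) (by omega))
    refine ⟨v, w, hv, hw, by omega, by omega, ?_, ?_⟩
    · rw [← hphi]; exact le_max_left _ _
    · rw [← hphiw]; exact le_max_right _ _
  · intro u hu hle
    by_contra hcon
    push Not at hcon
    have c1 : (ℓ : ℝ) / 3 < ((x ∩ u).card : ℝ) := by
      have : ℓ < 3 * (x ∩ u).card := by omega
      have : (ℓ : ℝ) < 3 * ((x ∩ u).card : ℝ) := by exact_mod_cast this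
      linarith
    have c2 : ((x ∩ u).card : ℝ) < (ℓ : ℝ) / 2 := by
      have : 2 * (x ∩ u).card < ℓ := by omega
      have : 2 * ((x ∩ u).card : ℝ) < ℓ := by exact_mod_cast this
      linarith
    have := hgap _ c1 c2
    have h2 := phi_le (Y := Y) (x := x) hu rfl
    linarith

theorem Good_prob {k K ℓ m0 : ℕ} {τ ρ : ℝ} (hn : 0 < n) (hτ : 0 < τ) {x : Finset (Fin n)}
    (hk : 0 < k) (hK : 0 < K) (hKn : K ≤ n) (hxk : x.card = k)
    (hℓ : 2000 ≤ ℓ) (hℓk : 400 * ℓ ≤ k) (hℓK : 400 * ℓ ≤ K) (hkK : k + K ≤ n)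
    (hm0 : m0 ≤ ℓ / 2000)
    (hN : ((Finset.univ.filter fun b : Finset (Fin n) => b.card ≤ K).card : ℝ) ≤ Real.exp (n * τ ^ 2))
    (hKτ : (K : ℝ) ≤ n * τ ^ 2)
    (hρ : 12 * Real.exp 1 * (k * K / (n * ℓ)) * Real.exp (n * τ ^ 2 / (4 * K)) ≤ ρ) (hρ2 : ρ ≤ 1 / 2) :
    mu n (Good K ℓ m0 τ x)ᶜ ≤ ENNReal.ofReal (4 * ρ + 4 * Real.exp (-(3 * K : ℝ)) +
      40000 * (k * K / (n * ℓ)) + 2 * Real.exp (-(ℓ : ℝ) / 12800000000)) := by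
  classical
  have hn' : (0 : ℝ) < n := by exact_mod_cast hn
  have hk' : (0 : ℝ) < k := by exact_mod_cast hk
  have hK' : (0 : ℝ) < K := by exact_mod_cast hK
  have hℓ' : (2000 : ℝ) ≤ ℓ := by exact_mod_cast hℓ
  have hℓ0 : (0 : ℝ) < ℓ := by linarith
  have hρ0 : 0 ≤ ρ := le_trans (by positivity) hρ
  -- counting
  have hN1 : (n.choose K : ℝ) ≤ Real.exp (n * τ ^ 2) := by
    refine le_trans ?_ hN
    have : n.choose K ≤ (Finset.univ.filter fun b : Finset (Fin n) => b.card ≤ K).card := by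
      have e : n.choose K = (Finset.powersetCard K (Finset.univ : Finset (Fin n))).card := by simp
      rw [e]
      apply Finset.card_le_card
      intro u hu
      simp at hu ⊢; omega
    exact_mod_cast this
  have m1b : (ℓ : ℝ) / 12 ≤ ((ℓ / 12 + 1 : ℕ) : ℝ) := by
    have : ℓ ≤ (ℓ / 12 + 1) * 12 := by omega
    have : (ℓ : ℝ) ≤ ((ℓ / 12 + 1 : ℕ) : ℝ) * 12 := by exact_mod_cast this
    linarith
  have m2a : (ℓ : ℝ) / 2000 ≤ ((ℓ / 2000 + 1 : ℕ) : ℝ) := by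
    have : ℓ ≤ (ℓ / 2000 + 1) * 2000 := by omega
    have : (ℓ : ℝ) ≤ ((ℓ / 2000 + 1 : ℕ) : ℝ) * 2000 := by exact_mod_cast this
    linarith
  have m2b : ((ℓ / 2000 + 1 : ℕ) : ℝ) ≤ ℓ / 1000 := by
    have : (ℓ / 2000 + 1) * 1000 ≤ ℓ := by omega
    have : (((ℓ / 2000 + 1 : ℕ) : ℝ)) * 1000 ≤ ℓ := by exact_mod_cast this
    linarith
  have U := upper_lemma hK hn hτ hKn hN1 x (m1 := ℓ / 12 + 1) (by omega) (ρ := ρ) (by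
    refine le_trans ?_ hρ
    rw [hxk]
    gcongr
    calc Real.exp 1 * k * K / (n * ((ℓ / 12 + 1 : ℕ) : ℝ)) ≤ Real.exp 1 * k * K / (n * ((ℓ : ℝ) / 12)) := by
          gcongr
      _ = _ := by field_simp) hρ2
  -- sets
  obtain ⟨a, ha, hac⟩ := Finset.exists_subset_card_eq (s := x) (n := m0) (by omega)
  obtain ⟨b, hb, hbc⟩ := Finset.exists_subset_card_eq (s := (Finset.univ \ x : Finset (Fin n)))
    (n := ℓ / 2000 + 1 - m0) (by
    rw [Finset.card_sdiff_of_subset (Finset.subset_univ _)]; simp; omega)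
  have hd : Disjoint b x := Finset.disjoint_of_subset_left hb Finset.sdiff_disjoint
  have habc : (a ∪ b).card = ℓ / 2000 + 1 := by
    rw [Finset.card_union_of_disjoint (hd.mono_right ha).symm, hac, hbc]; omega
  have hXc : ((x ∪ b).card : ℝ) ≤ 2 * k := by
    have : (x ∪ b).card ≤ 2 * k := by
      refine (Finset.card_union_le _ _).trans ?_
      omega
    exact_mod_cast this
  obtain ⟨A, hA, hAc⟩ := Finset.exists_subset_card_eq (s := x) (n := 400 * ℓ) (by omega)
  have L1 := lower_lemma hn hKn (m := ℓ / 2000 + 1) (by omega) (by omega) hτ hN (t := ℓ * τ / 2000)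
    (by positivity) (by
      calc ℓ * τ / 2000 = ℓ / 2000 * τ := by ring
        _ ≤ _ := by gcongr) (A := a ∪ b) (X := x ∪ b) (Finset.union_subset_union_left ha) habc
  have L2 := lower_lemma hn hKn (m := 400 * ℓ) (by omega) (by omega) hτ hN (t := ℓ * τ / 2000)
    (by positivity) (by
      push_cast
      nlinarith [mul_pos hℓ0 hτ]) hA hAc
  have hexp : Real.exp (-(3 * n * τ ^ 2)) ≤ Real.exp (-(3 * K : ℝ)) := by
    apply Real.exp_le_exp.2; linarith
  have B1 : 2 * Real.exp (-(3 * n * τ ^ 2)) + 5 * K * (x ∪ b).card * τ / (n * (ℓ * τ / 2000)) +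
        Real.exp (-((ℓ * τ / 2000) ^ 2 * n) / (8 * ((ℓ / 2000 + 1 : ℕ) : ℝ) * K)) ≤
      2 * Real.exp (-(3 * K : ℝ)) + 20000 * (k * K / (n * ℓ)) + Real.exp (-(ℓ : ℝ) / 12800000000) := by
    have e1 : 5 * K * (x ∪ b).card * τ / (n * (ℓ * τ / 2000)) ≤ 20000 * (k * K / (n * ℓ)) := by
      calc _ ≤ 5 * K * (2 * k) * τ / (n * (ℓ * τ / 2000)) := by gcongr
        _ = _ := by field_simp; norm_num
    have e2 : Real.exp (-((ℓ * τ / 2000) ^ 2 * n) / (8 * ((ℓ / 2000 + 1 : ℕ) : ℝ) * K)) ≤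
        Real.exp (-(ℓ : ℝ) / 12800000000) := by
      apply Real.exp_le_exp.2
      rw [neg_div, neg_div, neg_le_neg_iff]
      calc (ℓ : ℝ) / 12800000000 ≤ (ℓ / 2000) ^ 2 * K / (8 * (ℓ / 1000) * K) := by
            have : ((ℓ : ℝ) / 2000) ^ 2 * K / (8 * (ℓ / 1000) * K) = ℓ / 32000 := by
              field_simp; norm_num
            rw [this]; gcongr; norm_num
        _ ≤ (ℓ / 2000) ^ 2 * (n * τ ^ 2) / (8 * ((ℓ / 2000 + 1 : ℕ) : ℝ) * K) := by
            gcongr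
        _ = _ := by ring
    linarith
  have B2 : 2 * Real.exp (-(3 * n * τ ^ 2)) + 5 * K * x.card * τ / (n * (ℓ * τ / 2000)) +
        Real.exp (-((ℓ * τ / 2000) ^ 2 * n) / (8 * ((400 * ℓ : ℕ) : ℝ) * K)) ≤
      2 * Real.exp (-(3 * K : ℝ)) + 20000 * (k * K / (n * ℓ)) + Real.exp (-(ℓ : ℝ) / 12800000000) := by
    have e1 : 5 * K * x.card * τ / (n * (ℓ * τ / 2000)) ≤ 20000 * (k * K / (n * ℓ)) := by
      rw [hxk]
      calc _ ≤ 5 * K * (2 * k) * τ / (n * (ℓ * τ / 2000)) := by gcongr; linarith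
        _ = _ := by field_simp; norm_num
    have e2 : Real.exp (-((ℓ * τ / 2000) ^ 2 * n) / (8 * ((400 * ℓ : ℕ) : ℝ) * K)) ≤
        Real.exp (-(ℓ : ℝ) / 12800000000) := by
      apply Real.exp_le_exp.2
      rw [neg_div, neg_div, neg_le_neg_iff]
      push_cast
      calc (ℓ : ℝ) / 12800000000 = (ℓ / 2000) ^ 2 * K / (8 * (400 * ℓ) * K) := by
            field_simp; norm_num
        _ ≤ (ℓ / 2000) ^ 2 * (n * τ ^ 2) / (8 * (400 * ℓ) * K) := by
            gcongr
        _ = _ := by ring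
    linarith
  have L1' := L1.trans (ENNReal.ofReal_le_ofReal B1)
  have L2' := L2.trans (ENNReal.ofReal_le_ofReal B2)
  have hsub : (Good K ℓ m0 τ x)ᶜ ⊆ ({g | ¬ ∀ S : Finset (Fin n), S.card = K → ∀ M,
        (∀ u : Finset (Fin n), u.card = K → Qf u g ≤ M) →
        Qf S g + τ / 4 * (x ∩ S).card ≤ M + τ / 4 * ((ℓ / 12 + 1 : ℕ) : ℝ)} ∪
      {g | ¬ ∃ S : Finset (Fin n), S.card = K ∧ S ∩ (x ∪ b) = a ∪ b ∧
      ∀ u : Finset (Fin n), u.card = K →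
        Qf u g - 12 * ((ℓ / 2000 + 1 : ℕ) : ℝ) * τ - 5 * (ℓ * τ / 2000) ≤ Qf S g}) ∪
      {g | ¬ ∃ S : Finset (Fin n), S.card = K ∧ S ∩ x = A ∧
      ∀ u : Finset (Fin n), u.card = K →
        Qf u g - 12 * ((400 * ℓ : ℕ) : ℝ) * τ - 5 * (ℓ * τ / 2000) ≤ Qf S g} := by
    intro g hg
    by_contra hcon
    simp only [Set.mem_union, not_or, Set.mem_ofPred_eq, not_not] at hcon
    obtain ⟨⟨c1, S1, hS1, hS1x, c2⟩, S2, hS2, hS2x, c3⟩ := hcon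
    apply hg
    refine ⟨c1, ⟨S1, hS1, ?_, c2⟩, ⟨S2, hS2, ?_, c3⟩⟩
    · have : x ∩ S1 = a := by
        have e : x ∩ S1 = (S1 ∩ (x ∪ b)) ∩ x := by
          ext i; simp; tauto
        rw [e, hS1x, Finset.union_inter_distrib_right, Finset.disjoint_iff_inter_eq_empty.1 hd,
          Finset.union_empty, Finset.inter_eq_left.2 ha]
      rw [this, hac]
    · rw [Finset.inter_comm, hS2x, hAc]
  refine (measure_mono hsub).trans ((measure_union_le _ _).trans
    ((add_le_add ((measure_union_le _ _).trans (add_le_add U L1')) L2').trans ?_))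
  rw [← ENNReal.ofReal_add (by positivity) (by positivity), ← ENNReal.ofReal_add (by positivity) (by positivity)]
  apply ENNReal.ofReal_le_ofReal
  linarith

end part9

section part10
set_option linter.unusedSimpArgs false
set_option linter.unusedSectionVars false

theorem count_small {n K : ℕ} (hK : 0 < K) (hKn : K ≤ n) :
    ((Finset.univ.filter fun b : Finset (Fin n) => b.card ≤ K).card : ℝ) ≤
      Real.exp (K * (1 + Real.log ((n : ℝ) / K))) := by
  classical
  have hK' : (0 : ℝ) < K := by exact_mod_cast hK
  have hn' : (0 : ℝ) < n := by exact_mod_cast (lt_of_lt_of_le hK hKn)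
  have hKn' : (K : ℝ) ≤ n := by exact_mod_cast hKn
  have h1 : ∑ b ∈ Finset.univ.filter (fun b : Finset (Fin n) => b.card ≤ K), ((K : ℝ) / n) ^ K ≤
      (K / n + 1) ^ n := by
    have e := Finset.sum_pow_mul_eq_add_pow ((K : ℝ) / n) 1 (Finset.univ : Finset (Fin n))
    simp only [one_pow, mul_one, Finset.card_univ, Fintype.card_fin] at e
    rw [← e]
    calc _ ≤ ∑ b ∈ Finset.univ.filter (fun b : Finset (Fin n) => b.card ≤ K), ((K : ℝ) / n) ^ b.card := by
          refine Finset.sum_le_sum fun b hb => ?_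
          apply pow_le_pow_of_le_one (by positivity) ((div_le_one hn').2 hKn')
          simpa using hb
      _ ≤ _ := by
          apply Finset.sum_le_sum_of_subset_of_nonneg
          · intro b _; simp
          · intros; positivity
  have h2 : ((K : ℝ) / n + 1) ^ n ≤ Real.exp K := by
    calc ((K : ℝ) / n + 1) ^ n ≤ (Real.exp (K / n)) ^ n := by
          gcongr; exact Real.add_one_le_exp _
      _ = _ := by rw [← Real.exp_nat_mul]; congr 1; field_simp
  rw [Finset.sum_const, nsmul_eq_mul] at h1
  have h3 : Real.exp (K * (1 + Real.log ((n : ℝ) / K))) = Real.exp K * ((n : ℝ) / K) ^ K := by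
    rw [mul_add, mul_one, Real.exp_add, Real.exp_nat_mul, Real.exp_log (by positivity)]
  rw [h3]
  have h4 : ((K : ℝ) / n) ^ K * ((n : ℝ) / K) ^ K = 1 := by
    rw [← mul_pow]; field_simp; simp
  calc _ = ((Finset.univ.filter fun b : Finset (Fin n) => b.card ≤ K).card : ℝ) *
        (((K : ℝ) / n) ^ K * ((n : ℝ) / K) ^ K) := by rw [h4, mul_one]
    _ = ((Finset.univ.filter fun b : Finset (Fin n) => b.card ≤ K).card : ℝ) *
        (((K : ℝ) / n) ^ K) * ((n : ℝ) / K) ^ K := by ring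
    _ ≤ Real.exp K * ((n : ℝ) / K) ^ K := by
        gcongr
        exact h1.trans h2

noncomputable def Lgf (k' : ℕ → ℕ) (n : ℕ) : ℝ := 1 + Real.log ((n : ℝ) / k' n)
noncomputable def tauf (k' : ℕ → ℕ) (n : ℕ) : ℝ := Real.sqrt (k' n * Lgf k' n / n)
noncomputable def sf (k k' : ℕ → ℕ) (lam : ℕ → ℝ) (n : ℕ) : ℝ := k n / lam n * tauf k' n

section asym
variable {k k' : ℕ → ℕ} {lam : ℕ → ℝ}

theorem ev_pos (hkTop : Tendsto (fun n => k n) atTop atTop) : ∀ᶠ n : ℕ in atTop, (0 : ℝ) < k n := by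
  filter_upwards [hkTop.eventually_ge_atTop 1] with n hn
  exact_mod_cast hn

theorem ev_small (hko : (fun n => (k n : ℝ)) =o[atTop] fun n => (n : ℝ)) {c : ℝ} (hc : 0 < c) :
    ∀ᶠ n : ℕ in atTop, (k n : ℝ) ≤ c * n := by
  filter_upwards [hko.def hc] with n hn
  simpa using hn

theorem log_ratio_top (hkTop : Tendsto (fun n => k n) atTop atTop)
    (hko : (fun n => (k n : ℝ)) =o[atTop] fun n => (n : ℝ)) (B : ℝ) :
    ∀ᶠ n : ℕ in atTop, B ≤ Real.log ((n : ℝ) / k n) := by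
  filter_upwards [ev_pos hkTop, ev_small hko (Real.exp_pos (-B))] with n h1 h2
  rw [Real.le_log_iff_exp_le]
  · rw [le_div_iff₀ h1]
    calc Real.exp B * k n ≤ Real.exp B * (Real.exp (-B) * n) := by gcongr
      _ = n := by rw [← mul_assoc, ← Real.exp_add]; simp
  · have : 0 < Real.exp (-B) * n := lt_of_lt_of_le h1 h2
    have hn : (0 : ℝ) < n := (mul_pos_iff_of_pos_left (Real.exp_pos _)).1 this
    positivity

theorem lam_small (hlam : ∀ n, 0 < lam n) (hAL : AssumLambda k lam) {c : ℝ} (hc : 0 < c) :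
    ∀ᶠ n : ℕ in atTop, lam n ≤ c ∧ lam n * Real.sqrt n * Real.log n ≤ c * k n := by
  filter_upwards [hAL.2.def hc, eventually_ge_atTop 3] with n h1 h2
  have hn : (3 : ℝ) ≤ n := by exact_mod_cast h2
  have hlog : 0 < Real.log n := Real.log_pos (by linarith)
  have hs : 0 < Real.sqrt n := Real.sqrt_pos.2 (by linarith)
  have h3 : 0 ≤ min 1 ((k n : ℝ) / (Real.sqrt n * Real.log n)) := by positivity
  rw [Real.norm_of_nonneg (hlam n).le, Real.norm_of_nonneg h3] at h1
  constructor
  · calc lam n ≤ _ := h1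
      _ ≤ c * 1 := by gcongr; exact min_le_left _ _
      _ = c := mul_one c
  · have : lam n ≤ c * ((k n : ℝ) / (Real.sqrt n * Real.log n)) :=
      h1.trans (by gcongr; exact min_le_right _ _)
    rw [mul_div_assoc', le_div_iff₀ (by positivity)] at this
    linarith

theorem basics (hk'le : ∀ n, k' n ≤ n) (hk'Top : Tendsto (fun n => k' n) atTop atTop) :
    ∀ᶠ n : ℕ in atTop, (0 : ℝ) < n ∧ (0 : ℝ) < k' n ∧ 1 ≤ Lgf k' n ∧ 0 < tauf k' n ∧
      n * tauf k' n ^ 2 = k' n * Lgf k' n := by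
  filter_upwards [ev_pos hk'Top, eventually_ge_atTop 1] with n h1 h2
  have hn : (1 : ℝ) ≤ n := by exact_mod_cast h2
  have hle : (k' n : ℝ) ≤ n := by exact_mod_cast hk'le n
  have hL : 1 ≤ Lgf k' n := by
    unfold Lgf
    have : 0 ≤ Real.log ((n : ℝ) / k' n) := Real.log_nonneg ((one_le_div h1).2 hle)
    linarith
  have hpos : 0 < k' n * Lgf k' n / n := by positivity
  refine ⟨by linarith, h1, hL, Real.sqrt_pos.2 hpos, ?_⟩
  unfold tauf
  rw [Real.sq_sqrt hpos.le]; field_simp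

theorem A1 (hlam : ∀ n, 0 < lam n) (hk'le : ∀ n, k' n ≤ n)
    (hk'Top : Tendsto (fun n => k' n) atTop atTop)
    (hAK : AssumKprime k k' lam) {c : ℝ} (hc : 0 < c) :
    ∀ᶠ n : ℕ in atTop, sf k k' lam n ≤ c * k n := by
  filter_upwards [hAK.2.1.def (show 0 < c ^ 2 / 2 by positivity), basics hk'le hk'Top,
    eventually_ge_atTop 3] with n h1 ⟨hn, hK, hL, hτ, hτ2⟩ h3
  have h3' : (3 : ℝ) ≤ n := by exact_mod_cast h3
  have hlog : 1 ≤ Real.log n := by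
    rw [Real.le_log_iff_exp_le hn]
    linarith [Real.exp_one_lt_d9]
  have hl := hlam n
  rw [Real.norm_of_nonneg hK.le, Real.norm_of_nonneg (by positivity)] at h1
  have hL2 : Lgf k' n ≤ 2 * Real.log n := by
    unfold Lgf
    have : Real.log ((n : ℝ) / k' n) ≤ Real.log n := by
      apply Real.log_le_log (by positivity)
      apply div_le_self hn.le
      have : 1 ≤ k' n := by exact_mod_cast hK
      exact_mod_cast this
    linarith
  have hτl : tauf k' n ≤ c * lam n := by
    apply le_of_sq_le_sq _ (by positivity)
    have e : tauf k' n ^ 2 = k' n * Lgf k' n / n := by rw [← hτ2]; field_simp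
    rw [e, div_le_iff₀ hn]
    rw [mul_div_assoc', le_div_iff₀ (by positivity)] at h1
    have hl3 : Real.log n ≤ Real.log n ^ 3 := le_self_pow₀ hlog (by norm_num)
    calc (k' n : ℝ) * Lgf k' n ≤ k' n * (2 * Real.log n ^ 3) := by gcongr; linarith
      _ ≤ _ := by nlinarith
  unfold sf
  rw [div_mul_eq_mul_div, div_le_iff₀ hl]
  calc (k n : ℝ) * tauf k' n ≤ k n * (c * lam n) := by gcongr
    _ = _ := by ring

theorem A3 (hlam : ∀ n, 0 < lam n) (hk'le : ∀ n, k' n ≤ n)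
    (hkTop : Tendsto (fun n => k n) atTop atTop)
    (hk'Top : Tendsto (fun n => k' n) atTop atTop)
    (hAL : AssumLambda k lam) {c : ℝ} (hc : 0 < c) :
    ∀ᶠ n : ℕ in atTop, Real.sqrt (k' n) ≤ c * sf k k' lam n := by
  filter_upwards [lam_small hlam hAL hc, basics hk'le hk'Top, ev_pos hkTop,
    eventually_ge_atTop 3] with n ⟨_, h1⟩ ⟨hn, hK, hL, hτ, hτ2⟩ hk h3
  have h3' : (3 : ℝ) ≤ n := by exact_mod_cast h3
  have hlog : 1 ≤ Real.log n := by
    rw [Real.le_log_iff_exp_le hn]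
    linarith [Real.exp_one_lt_d9]
  have hl := hlam n
  have hsn : 0 < Real.sqrt n := Real.sqrt_pos.2 hn
  have h2 : lam n * Real.sqrt n ≤ c * k n := by
    refine le_trans ?_ h1
    exact le_mul_of_one_le_right (by positivity) hlog
  have h4 : Real.sqrt (k' n) ≤ Real.sqrt n * tauf k' n := by
    apply Real.sqrt_le_iff.2 ⟨by positivity, ?_⟩
    rw [mul_pow, Real.sq_sqrt hn.le, hτ2]
    exact le_mul_of_one_le_right hK.le hL
  unfold sf
  calc Real.sqrt (k' n) ≤ Real.sqrt n * tauf k' n := h4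
    _ = (lam n * Real.sqrt n) / lam n * tauf k' n := by field_simp
    _ ≤ (c * k n) / lam n * tauf k' n := by gcongr
    _ = _ := by ring

theorem A4 (hlam : ∀ n, 0 < lam n) (hk'le : ∀ n, k' n ≤ n)
    (hkTop : Tendsto (fun n => k n) atTop atTop)
    (hk'Top : Tendsto (fun n => k' n) atTop atTop)
    (hAL : AssumLambda k lam) {c : ℝ} (hc : 0 < c) :
    ∀ᶠ n : ℕ in atTop, k n * k' n / n * Real.exp (Lgf k' n / 4) ≤ c * sf k k' lam n := by
  filter_upwards [lam_small hlam hAL (show 0 < c / 3 by positivity), basics hk'le hk'Top, ev_pos hkTop] with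
    n ⟨h1, _⟩ ⟨hn, hK, hL, hτ, hτ2⟩ hk
  have hl := hlam n
  have hKn : (k' n : ℝ) / n = Real.exp (1 - Lgf k' n) := by
    unfold Lgf
    have : 1 - (1 + Real.log ((n : ℝ) / k' n)) = -Real.log ((n : ℝ) / k' n) := by ring
    rw [this, Real.exp_neg, Real.exp_log (by positivity), inv_div]
  have hτge : Real.exp ((1 - Lgf k' n) / 2) ≤ tauf k' n := by
    apply le_of_sq_le_sq _ hτ.le
    rw [← Real.exp_nat_mul]
    have e : tauf k' n ^ 2 = k' n / n * Lgf k' n := by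
      have : tauf k' n ^ 2 = (n * tauf k' n ^ 2) / n := by field_simp
      rw [this, hτ2]; ring
    rw [e, hKn]
    have : ((2 : ℕ) : ℝ) * ((1 - Lgf k' n) / 2) = 1 - Lgf k' n := by push_cast; ring
    rw [this]
    exact le_mul_of_one_le_right (Real.exp_nonneg _) hL
  have key : (k' n : ℝ) / n * Real.exp (Lgf k' n / 4) ≤ 3 * tauf k' n := by
    rw [hKn, ← Real.exp_add]
    calc Real.exp (1 - Lgf k' n + Lgf k' n / 4) ≤ Real.exp (1 + (1 - Lgf k' n) / 2) := by
          apply Real.exp_le_exp.2; linarith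
      _ = Real.exp 1 * Real.exp ((1 - Lgf k' n) / 2) := Real.exp_add _ _
      _ ≤ 3 * tauf k' n := by
          gcongr
          linarith [Real.exp_one_lt_d9]
  unfold sf
  calc k n * k' n / n * Real.exp (Lgf k' n / 4) = k n * ((k' n : ℝ) / n * Real.exp (Lgf k' n / 4)) := by ring
    _ ≤ k n * (3 * tauf k' n) := by gcongr
    _ = 3 * lam n * (k n / lam n * tauf k' n) := by field_simp
    _ ≤ c * (k n / lam n * tauf k' n) := by gcongr; linarith

theorem A2 (hlam : ∀ n, 0 < lam n) (hk'le : ∀ n, k' n ≤ n)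
    (hkTop : Tendsto (fun n => k n) atTop atTop)
    (hk'Top : Tendsto (fun n => k' n) atTop atTop)
    (hko : (fun n => (k n : ℝ)) =o[atTop] fun n => (n : ℝ))
    (hAL : AssumLambda k lam) (hAK : AssumKprime k k' lam) {c : ℝ} (hc : 0 < c) :
    ∀ᶠ n : ℕ in atTop, sf k k' lam n ≤ c * k' n := by
  filter_upwards [hAK.1.def (show 0 < min 1 (c ^ 2 / 3) by positivity), basics hk'le hk'Top, ev_pos hkTop,
    log_ratio_top hkTop hko 1, lam_small hlam hAL one_pos, hAL.1.def (show (0:ℝ) < 1 / 3 by norm_num)] with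
    n h1 ⟨hn, hK, hL, hτ, hτ2⟩ hk hln ⟨hl1, _⟩ hX
  have hl := hlam n
  set ln := Real.log ((n : ℝ) / k n) with hlndef
  have hln0 : 0 < ln := by linarith
  rw [Real.norm_of_nonneg hl.le, Real.norm_of_nonneg (by positivity)] at hX
  set Xn := lam n * n / (k n * ln) with hXn
  have hX3 : 3 ≤ Xn := by
    rw [hXn, le_div_iff₀ (by positivity)]
    rw [div_mul_eq_mul_div, div_le_iff₀ hn] at hX
    linarith
  have hXle : Xn ≤ n / k n := by
    rw [hXn, div_le_div_iff₀ (by positivity) hk]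
    have : lam n * n * k n ≤ 1 * n * k n := by gcongr
    have h5 : (n : ℝ) * k n * 1 ≤ n * k n * ln := by gcongr
    nlinarith
  have hlX : Real.log Xn ≤ ln := Real.log_le_log (by linarith) hXle
  have hlX0 : 0 < Real.log Xn := Real.log_pos (by linarith)
  rw [Real.norm_of_nonneg hK.le, Real.norm_of_nonneg (by positivity)] at h1
  have hQ : (k n : ℝ) ^ 2 / (lam n ^ 2 * n) * ln ≤ min 1 (c ^ 2 / 3) * (k' n : ℝ) := by
    refine le_trans ?_ h1
    rw [le_div_iff₀ hlX0, sq ln, ← mul_assoc]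
    gcongr
  have hQ1 : (k n : ℝ) ^ 2 / n ≤ (k' n : ℝ) := by
    calc (k n : ℝ) ^ 2 / n ≤ (k n : ℝ) ^ 2 / (lam n ^ 2 * n) * ln := by
          have e : (k n : ℝ) ^ 2 / n = (k n : ℝ) ^ 2 / (1 * n) * 1 := by ring
          rw [e]
          gcongr
          exact pow_le_one₀ hl.le hl1
      _ ≤ min 1 (c ^ 2 / 3) * (k' n : ℝ) := hQ
      _ ≤ 1 * (k' n : ℝ) := by gcongr; exact min_le_left _ _
      _ = (k' n : ℝ) := one_mul _
  have hLle : Lgf k' n ≤ 3 * ln := by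
    unfold Lgf
    have : Real.log ((n : ℝ) / k' n) ≤ 2 * ln := by
      have e : 2 * ln = Real.log (((n : ℝ) / k n) ^ 2) := by rw [Real.log_pow, ← hlndef]; norm_num
      rw [e]
      apply Real.log_le_log (by positivity)
      rw [div_pow, div_le_div_iff₀ hK (by positivity)]
      rw [div_le_iff₀ hn] at hQ1
      nlinarith
    linarith
  apply le_of_sq_le_sq _ (by positivity)
  unfold sf
  have e : tauf k' n ^ 2 = k' n * Lgf k' n / n := by rw [← hτ2]; field_simp
  rw [mul_pow, e]
  calc (k n / lam n) ^ 2 * (k' n * Lgf k' n / n) ≤ (k n / lam n) ^ 2 * (k' n * (3 * ln) / n) := by gcongr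
    _ = 3 * ((k n : ℝ) ^ 2 / (lam n ^ 2 * n) * ln) * k' n := by field_simp
    _ ≤ 3 * ((c ^ 2 / 3) * k' n) * k' n := by
        have h9 : (k n : ℝ) ^ 2 / (lam n ^ 2 * n) * ln ≤ (c ^ 2 / 3) * (k' n : ℝ) := by
          refine hQ.trans ?_
          gcongr
          exact min_le_right _ _
        exact mul_le_mul_of_nonneg_right (mul_le_mul_of_nonneg_left h9 (by norm_num)) hK.le
    _ = _ := by ring

theorem A0 (hlam : ∀ n, 0 < lam n) (hk'le : ∀ n, k' n ≤ n)
    (hkTop : Tendsto (fun n => k n) atTop atTop)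
    (hk'Top : Tendsto (fun n => k' n) atTop atTop)
    (hAL : AssumLambda k lam) (B : ℝ) :
    ∀ᶠ n : ℕ in atTop, B ≤ sf k k' lam n := by
  filter_upwards [A3 hlam hk'le hkTop hk'Top hAL one_pos,
    hk'Top.eventually_ge_atTop (⌈B⌉₊ ^ 2)] with n h1 h2
  have h2' : ((⌈B⌉₊ : ℝ)) ^ 2 ≤ k' n := by exact_mod_cast h2
  calc B ≤ ⌈B⌉₊ := Nat.le_ceil B
    _ ≤ Real.sqrt (k' n) := Real.le_sqrt_of_sq_le h2'
    _ ≤ _ := by simpa using h1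

end asym

end part10

section part11
set_option linter.unusedSimpArgs false
set_option linter.unusedSectionVars false

section fin
variable {k k' : ℕ → ℕ} {lam : ℕ → ℝ}

noncomputable def ellf (k k' : ℕ → ℕ) (lam : ℕ → ℝ) (n : ℕ) : ℕ := ⌈sf k k' lam n / 32⌉₊

theorem ell_bd (hlam : ∀ n, 0 < lam n) (hk'le : ∀ n, k' n ≤ n)
    (hkTop : Tendsto (fun n => k n) atTop atTop)
    (hk'Top : Tendsto (fun n => k' n) atTop atTop)
    (hAL : AssumLambda k lam) :
    ∀ᶠ n : ℕ in atTop, 0 < sf k k' lam n ∧ sf k k' lam n / 32 ≤ ellf k k' lam n ∧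
      (ellf k k' lam n : ℝ) ≤ sf k k' lam n / 16 := by
  filter_upwards [A0 hlam hk'le hkTop hk'Top hAL 32] with n h
  refine ⟨by linarith, Nat.le_ceil _, ?_⟩
  have := Nat.ceil_lt_add_one (show 0 ≤ sf k k' lam n / 32 by linarith)
  unfold ellf
  linarith

theorem C1 (hlam : ∀ n, 0 < lam n) (hk'le : ∀ n, k' n ≤ n)
    (hkTop : Tendsto (fun n => k n) atTop atTop)
    (hk'Top : Tendsto (fun n => k' n) atTop atTop)
    (hAL : AssumLambda k lam) {c : ℝ} (hc : 0 < c) :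
    ∀ᶠ n : ℕ in atTop, (k n : ℝ) * k' n / n * Real.exp (Lgf k' n / 4) ≤ c * ellf k k' lam n := by
  filter_upwards [A4 hlam hk'le hkTop hk'Top hAL (show 0 < c / 32 by positivity),
    ell_bd hlam hk'le hkTop hk'Top hAL] with n h ⟨_, h2, _⟩
  refine h.trans ?_
  have := mul_le_mul_of_nonneg_left h2 hc.le
  linarith

theorem C1' (hlam : ∀ n, 0 < lam n) (hk'le : ∀ n, k' n ≤ n)
    (hkTop : Tendsto (fun n => k n) atTop atTop)
    (hk'Top : Tendsto (fun n => k' n) atTop atTop)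
    (hAL : AssumLambda k lam) {c : ℝ} (hc : 0 < c) :
    ∀ᶠ n : ℕ in atTop, (k n : ℝ) * k' n / n ≤ c * ellf k k' lam n := by
  filter_upwards [C1 hlam hk'le hkTop hk'Top hAL hc, basics hk'le hk'Top] with n h ⟨_, _, hL, _, _⟩
  refine le_trans ?_ h
  apply le_mul_of_one_le_right (by positivity)
  apply Real.one_le_exp; linarith

theorem C2 (hlam : ∀ n, 0 < lam n) (hk'le : ∀ n, k' n ≤ n)
    (hkTop : Tendsto (fun n => k n) atTop atTop)
    (hk'Top : Tendsto (fun n => k' n) atTop atTop)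
    (hko : (fun n => (k n : ℝ)) =o[atTop] fun n => (n : ℝ))
    (hAL : AssumLambda k lam) (hAK : AssumKprime k k' lam) {c : ℝ} (hc : 0 < c) :
    ∀ᶠ n : ℕ in atTop, (ellf k k' lam n : ℝ) ≤ c * k n ∧ (ellf k k' lam n : ℝ) ≤ c * k' n := by
  filter_upwards [A1 hlam hk'le hk'Top hAK hc, A2 hlam hk'le hkTop hk'Top hko hAL hAK hc,
    ell_bd hlam hk'le hkTop hk'Top hAL] with n h1 h2 ⟨h3, h4, h5⟩
  constructor <;> linarith

theorem C3 (hlam : ∀ n, 0 < lam n) (hk'le : ∀ n, k' n ≤ n)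
    (hkTop : Tendsto (fun n => k n) atTop atTop)
    (hk'Top : Tendsto (fun n => k' n) atTop atTop)
    (hAL : AssumLambda k lam) {c : ℝ} (hc : 0 < c) :
    ∀ᶠ n : ℕ in atTop, Real.sqrt (k' n : ℝ) ≤ c * ellf k k' lam n := by
  filter_upwards [A3 hlam hk'le hkTop hk'Top hAL (show 0 < c / 32 by positivity),
    ell_bd hlam hk'le hkTop hk'Top hAL] with n h ⟨_, h2, _⟩
  refine h.trans ?_
  have := mul_le_mul_of_nonneg_left h2 hc.le
  linarith

theorem C5 (hlam : ∀ n, 0 < lam n) (hk'le : ∀ n, k' n ≤ n)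
    (hkTop : Tendsto (fun n => k n) atTop atTop)
    (hk'Top : Tendsto (fun n => k' n) atTop atTop)
    (hk'o : (fun n => (k' n : ℝ)) =o[atTop] fun n => (n : ℝ))
    (hAL : AssumLambda k lam) :
    ∀ᶠ n : ℕ in atTop, (ellf k k' lam n : ℝ) ≤ 1 * ((k n : ℝ) / lam n *
      Real.sqrt ((k' n : ℝ) / n * Real.log ((n : ℝ) / (k' n : ℝ)))) := by
  filter_upwards [ell_bd hlam hk'le hkTop hk'Top hAL, basics hk'le hk'Top,
    log_ratio_top hk'Top hk'o 1] with n ⟨h3, h4, h5⟩ ⟨hn, hK, hL, _, _⟩ hlog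
  have hl := hlam n
  have h6 : tauf k' n ≤ 2 * Real.sqrt ((k' n : ℝ) / n * Real.log ((n : ℝ) / (k' n : ℝ))) := by
    unfold tauf Lgf
    rw [show (2 : ℝ) = Real.sqrt 4 by rw [show (4:ℝ) = 2 ^ 2 by norm_num]; simp, ← Real.sqrt_mul (by norm_num)]
    apply Real.sqrt_le_sqrt
    rw [mul_div_right_comm]
    have : (0:ℝ) ≤ (k' n : ℝ) / n := by positivity
    nlinarith
  have h7 : sf k k' lam n ≤ k n / lam n * (2 * Real.sqrt ((k' n : ℝ) / n * Real.log ((n : ℝ) / (k' n : ℝ)))) := by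
    unfold sf; gcongr
  have h8 : 0 ≤ (k n : ℝ) / lam n * Real.sqrt ((k' n : ℝ) / n * Real.log ((n : ℝ) / (k' n : ℝ))) := by positivity
  nlinarith

/-- The arithmetic side conditions that hold eventually. -/
theorem ev_cond (hlam : ∀ n, 0 < lam n) (hk'le : ∀ n, k' n ≤ n)
    (hkTop : Tendsto (fun n => k n) atTop atTop)
    (hk'Top : Tendsto (fun n => k' n) atTop atTop)
    (hko : (fun n => (k n : ℝ)) =o[atTop] fun n => (n : ℝ))
    (hk'o : (fun n => (k' n : ℝ)) =o[atTop] fun n => (n : ℝ))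
    (hAL : AssumLambda k lam) (hAK : AssumKprime k k' lam) :
    ∀ᶠ n : ℕ in atTop, 0 < k n ∧ 2000 ≤ ellf k k' lam n ∧ 400 * ellf k k' lam n ≤ k n ∧
      400 * ellf k k' lam n ≤ k' n ∧ k n + k' n ≤ n ∧ k' n * k n / n ≤ ellf k k' lam n / 2000 ∧
      lam n * ellf k k' lam n / k n ≤ tauf k' n / 16 ∧
      tauf k' n / 32 ≤ lam n * ellf k k' lam n / k n ∧
      0 < (1 : ℝ) * ((k' n : ℝ) * (k n : ℝ) / (lam n * n)) ∧
      (1 : ℝ) * ((k' n : ℝ) * (k n : ℝ) / (lam n * n)) ≤ ellf k k' lam n * tauf k' n / 100 := by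
  filter_upwards [ell_bd hlam hk'le hkTop hk'Top hAL, basics hk'le hk'Top,
    log_ratio_top hk'Top hk'o 3200, ev_pos hkTop,
    A0 hlam hk'le hkTop hk'Top hAL 64000,
    C2 hlam hk'le hkTop hk'Top hko hAL hAK (show (0:ℝ) < 1 / 400 by norm_num),
    ev_small hko (show (0:ℝ) < 1 / 2 by norm_num), ev_small hk'o (show (0:ℝ) < 1 / 2 by norm_num),
    C1' hlam hk'le hkTop hk'Top hAL (show (0:ℝ) < 1 / 2000 by norm_num)]
    with n ⟨h3, h4, h5⟩ ⟨hn, hK, hL, hτ, hτ2⟩ hlog hk h0 ⟨hc1, hc2⟩ hs1 hs2 hm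
  have hl := hlam n
  have hsf : sf k k' lam n = k n / lam n * tauf k' n := rfl
  refine ⟨by exact_mod_cast hk, ?_, ?_, ?_, ?_, ?_, ?_, ?_, by positivity, ?_⟩
  · have : (2000 : ℝ) ≤ ellf k k' lam n := by linarith
    exact_mod_cast this
  · have : (400 : ℝ) * ellf k k' lam n ≤ k n := by linarith
    exact_mod_cast this
  · have : (400 : ℝ) * ellf k k' lam n ≤ k' n := by linarith
    exact_mod_cast this
  · have : (k n : ℝ) + k' n ≤ n := by linarith
    exact_mod_cast this
  · rw [Nat.le_div_iff_mul_le (by norm_num)]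
    have h1 : ((k' n * k n / n : ℕ) : ℝ) ≤ (k' n * k n : ℝ) / n := by
      have := @Nat.cast_div_le ℝ _ _ _ (k' n * k n) n
      push_cast at this
      exact this
    have : ((k' n * k n / n : ℕ) : ℝ) * 2000 ≤ ellf k k' lam n := by
      rw [mul_comm (k n : ℝ)] at hm
      linarith
    exact_mod_cast this
  · rw [div_le_iff₀ hk]
    have : lam n * ellf k k' lam n ≤ lam n * (sf k k' lam n / 16) := by gcongr
    refine this.trans (le_of_eq ?_)
    rw [hsf]; field_simp
  · rw [le_div_iff₀ hk]
    have : lam n * (sf k k' lam n / 32) ≤ lam n * ellf k k' lam n := by gcongr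
    refine le_trans (le_of_eq ?_) this
    rw [hsf]; field_simp
  · have h1 : sf k k' lam n / 32 * tauf k' n / 100 ≤ ellf k k' lam n * tauf k' n / 100 := by gcongr
    refine le_trans ?_ h1
    have h2 : sf k k' lam n / 32 * tauf k' n / 100 =
        ((k' n : ℝ) * (k n : ℝ) / (lam n * n)) * (Lgf k' n / 3200) := by
      have e : tauf k' n ^ 2 = k' n * Lgf k' n / n := by rw [← hτ2]; field_simp
      calc sf k k' lam n / 32 * tauf k' n / 100 = k n / lam n * tauf k' n ^ 2 / 3200 := by rw [hsf]; ring
        _ = _ := by rw [e]; field_simp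
    rw [h2, one_mul]
    apply le_mul_of_one_le_right (by positivity)
    rw [le_div_iff₀ (by norm_num)]
    unfold Lgf
    linarith

theorem bad_small (hlam : ∀ n, 0 < lam n) (x : ∀ n, Finset (Fin n)) (hx : ∀ n, (x n).card = k n)
    (hk'le : ∀ n, k' n ≤ n)
    (hkTop : Tendsto (fun n => k n) atTop atTop)
    (hk'Top : Tendsto (fun n => k' n) atTop atTop)
    (hko : (fun n => (k n : ℝ)) =o[atTop] fun n => (n : ℝ))
    (hk'o : (fun n => (k' n : ℝ)) =o[atTop] fun n => (n : ℝ))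
    (hAL : AssumLambda k lam) (hAK : AssumKprime k k' lam) {ε : ℝ} (hε : 0 < ε) :
    ∀ᶠ n : ℕ in atTop,
      mu n (Good (k' n) (ellf k k' lam n) (k' n * k n / n) (tauf k' n) (x n))ᶜ ≤ ENNReal.ofReal ε := by
  have he := Real.exp_pos 1
  have hρ : 0 < min (1 / 2) (ε / 16) := by positivity
  filter_upwards [ev_cond hlam hk'le hkTop hk'Top hko hk'o hAL hAK, basics hk'le hk'Top,
    ell_bd hlam hk'le hkTop hk'Top hAL,
    A0 hlam hk'le hkTop hk'Top hAL (32 * (12800000000 * -Real.log (ε / 8))),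
    hk'Top.eventually_ge_atTop ⌈-Real.log (ε / 16)⌉₊,
    C1 hlam hk'le hkTop hk'Top hAL (show 0 < min (1 / 2) (ε / 16) / (12 * Real.exp 1) by positivity),
    C1' hlam hk'le hkTop hk'Top hAL (show 0 < ε / 160000 by positivity)]
    with n ⟨hk, hℓ, hℓk, hℓK, hkK, hm0, h1, h2, hD, hD2⟩ ⟨hn, hK, hL, hτ, hτ2⟩ ⟨_, h4, _⟩ h0 hKbig c1 c2
  have hℓ0 : (0 : ℝ) < ellf k k' lam n := by
    have : 0 < ellf k k' lam n := by omega
    exact_mod_cast this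
  have hKn : 0 < k' n := by exact_mod_cast hK
  have hnn : 0 < n := by exact_mod_cast hn
  have hkey := Good_prob (n := n) (k := k n) (K := k' n) (ℓ := ellf k k' lam n) (m0 := k' n * k n / n)
    (τ := tauf k' n) (ρ := min (1 / 2) (ε / 16)) hnn hτ hk hKn (hk'le n) (hx n) hℓ hℓk hℓK hkK hm0
    (by rw [hτ2]; exact count_small hKn (hk'le n))
    (by rw [hτ2]; exact le_mul_of_one_le_right hK.le hL)
    (by
      have e : (k' n : ℝ) * Lgf k' n / (4 * k' n) = Lgf k' n / 4 := by field_simp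
      rw [hτ2, e]
      calc 12 * Real.exp 1 * (k n * k' n / (n * ellf k k' lam n)) * Real.exp (Lgf k' n / 4)
          = 12 * Real.exp 1 * ((k n : ℝ) * k' n / n * Real.exp (Lgf k' n / 4)) / ellf k k' lam n := by
            field_simp
        _ ≤ 12 * Real.exp 1 * (min (1 / 2) (ε / 16) / (12 * Real.exp 1) * ellf k k' lam n) /
              ellf k k' lam n := by gcongr
        _ = min (1 / 2) (ε / 16) := by field_simp)
    (min_le_left _ _)
  refine hkey.trans (ENNReal.ofReal_le_ofReal ?_)
  have e1 : min (1 / 2) (ε / 16) ≤ ε / 16 := min_le_right _ _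
  have e2 : Real.exp (-(3 * k' n : ℝ)) ≤ ε / 16 := by
    rw [← Real.le_log_iff_exp_le (by positivity)]
    have := Nat.ceil_le.1 hKbig
    linarith
  have e3 : (k n : ℝ) * k' n / (n * ellf k k' lam n) ≤ ε / 160000 := by
    rw [← div_div, div_le_iff₀ hℓ0]; exact c2
  have e4 : Real.exp (-(ellf k k' lam n : ℝ) / 12800000000) ≤ ε / 8 := by
    rw [← Real.le_log_iff_exp_le (by positivity)]
    rw [div_le_iff₀ (by norm_num)]
    linarith
  linarith

theorem symG_meas (n : ℕ) : Measurable (symG (n := n)) := by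
  unfold symG; fun_prop

theorem whp (hlam : ∀ n, 0 < lam n) (x : ∀ n, Finset (Fin n)) (hx : ∀ n, (x n).card = k n)
    (hk'le : ∀ n, k' n ≤ n)
    (hkTop : Tendsto (fun n => k n) atTop atTop)
    (hk'Top : Tendsto (fun n => k' n) atTop atTop)
    (hko : (fun n => (k n : ℝ)) =o[atTop] fun n => (n : ℝ))
    (hk'o : (fun n => (k' n : ℝ)) =o[atTop] fun n => (n : ℝ))
    (hAL : AssumLambda k lam) (hAK : AssumKprime k k' lam)
    (E : ∀ n, Set (Fin n → Fin n → ℝ))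
    (hE : ∀ᶠ n in atTop, ∀ g ∈ Good (k' n) (ellf k k' lam n) (k' n * k n / n) (tauf k' n) (x n),
      symG g ∈ E n) :
    Tendsto (fun n => goeMeasure n (E n)) atTop (nhds 1) := by
  have hp : ∀ n, IsProbabilityMeasure (goeMeasure n) := fun n => by
    rw [goe_eq]; exact Measure.isProbabilityMeasure_map (symG_meas n).aemeasurable
  rw [ENNReal.tendsto_nhds (by simp)]
  intro ε hε
  obtain ⟨δ, hδ0, hδ⟩ : ∃ δ : ℝ, 0 < δ ∧ ENNReal.ofReal δ ≤ ε := by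
    rcases eq_or_ne ε ⊤ with h | h
    · exact ⟨1, one_pos, by simp [h]⟩
    · exact ⟨ε.toReal, ENNReal.toReal_pos hε.ne' h, by rw [ENNReal.ofReal_toReal h]⟩
  filter_upwards [hE, bad_small hlam x hx hk'le hkTop hk'Top hko hk'o hAL hAK hδ0] with n h1 h2
  have := hp n
  refine ⟨?_, prob_le_one.trans le_self_add⟩
  have h3 : mu n (Good (k' n) (ellf k k' lam n) (k' n * k n / n) (tauf k' n) (x n)) ≤ goeMeasure n (E n) := by
    rw [goe_eq]
    exact (measure_mono h1).trans (Measure.le_map_apply (symG_meas n).aemeasurable _)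
  have h4 : (1 : ENNReal) ≤ mu n (Good (k' n) (ellf k k' lam n) (k' n * k n / n) (tauf k' n) (x n)) +
      mu n (Good (k' n) (ellf k k' lam n) (k' n * k n / n) (tauf k' n) (x n))ᶜ := by
    rw [← measure_univ (μ := mu n), ← Set.union_compl_self]
    exact measure_union_le _ _
  rw [tsub_le_iff_right]
  exact h4.trans (add_le_add h3 (h2.trans hδ))
end fin

end part11

/-- Theorem: quantitative Overlap Gap Property.
Under Assumptions (λ) and (k') with `k, k' ≤ n`, `k, k' → ∞`, `k, k' = o(n)`, there exist
constants `C₀ > 1`, `D₀ > 0` and a sequence of integer overlaps `ℓ = ℓ_n` such that: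
(i) `ℓ = ω(kk'/n)`, `ℓ = o(min{k,k'})`, `ℓ = O((k/λ)·√((k'/n)·log(n/k')))`, `ℓ = ω(√k')`;
(ii) w.h.p. over `W ∼ GOE(n)`,
`min_{ℓ' ∈ (ℓ/3, ℓ/2)} φ_{k'}(ℓ') ≥ max{φ_{k'}(⌊k'k/n⌋), φ_{k'}(C₀ℓ)} + D₀·(k'k)/(λn)`;
and in particular `Φ_{k'}` exhibits the `k'`-OGP with `ζ₂ - ζ₁ = Θ(ℓ) = ω(√k')` w.h.p. -/
theorem stmt_13 (k k' : ℕ → ℕ) (lam : ℕ → ℝ) (hlam : ∀ n, 0 < lam n)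
    (x : ∀ n, Finset (Fin n)) (hx : ∀ n, (x n).card = k n)
    (hkle : ∀ n, k n ≤ n) (hk'le : ∀ n, k' n ≤ n)
    (hkTop : Tendsto (fun n => k n) atTop atTop) (hk'Top : Tendsto (fun n => k' n) atTop atTop)
    (hko : (fun n => (k n : ℝ)) =o[atTop] fun n => (n : ℝ))
    (hk'o : (fun n => (k' n : ℝ)) =o[atTop] fun n => (n : ℝ))
    (hAL : AssumLambda k lam) (hAK : AssumKprime k k' lam) :
    ∃ C₀ : ℕ, 1 < C₀ ∧ ∃ D₀ : ℝ, 0 < D₀ ∧ ∃ ℓ : ℕ → ℕ,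
      -- (i) asymptotics of ℓ
      ((fun n => (k n : ℝ) * (k' n : ℝ) / n) =o[atTop] fun n => (ℓ n : ℝ)) ∧
      ((fun n => (ℓ n : ℝ)) =o[atTop] fun n => (min (k n) (k' n) : ℝ)) ∧
      ((fun n => (ℓ n : ℝ)) =O[atTop] fun n =>
        (k n : ℝ) / lam n * Real.sqrt ((k' n : ℝ) / n * Real.log ((n : ℝ) / (k' n : ℝ)))) ∧
      ((fun n => Real.sqrt (k' n : ℝ)) =o[atTop] fun n => (ℓ n : ℝ)) ∧
      -- (ii) the gap in φ_{k'}, with high probability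
      Tendsto (fun n => goeMeasure n
        {W | ∀ ℓ' : ℕ, (ℓ n : ℝ) / 3 < (ℓ' : ℝ) → (ℓ' : ℝ) < (ℓ n : ℝ) / 2 →
          max (phiVal (k' n) (k' n * k n / n) (Ymat (k n) (lam n) (x n) W) (x n))
              (phiVal (k' n) (C₀ * ℓ n) (Ymat (k n) (lam n) (x n) W) (x n)) +
            D₀ * ((k' n : ℝ) * (k n : ℝ) / (lam n * n)) ≤
          phiVal (k' n) ℓ' (Ymat (k n) (lam n) (x n) W) (x n)})
        atTop (nhds 1) ∧
      -- in particular: k'-OGP with ζ₂ - ζ₁ = Θ(ℓ) = ω(√k'), with high probability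
      ∃ ζ₁ ζ₂ : ℕ → ℕ,
        ((fun n => (ζ₂ n : ℝ) - (ζ₁ n : ℝ)) =Θ[atTop] fun n => (ℓ n : ℝ)) ∧
        ((fun n => Real.sqrt (k' n : ℝ)) =o[atTop] fun n => (ζ₂ n : ℝ) - (ζ₁ n : ℝ)) ∧
        Tendsto (fun n => goeMeasure n
          {W | hasOGP (k n) (k' n) (Ymat (k n) (lam n) (x n) W) (x n) (ζ₁ n) (ζ₂ n)})
          atTop (nhds 1) := by
  have hsq : (fun n => Real.sqrt (k' n : ℝ)) =o[atTop] fun n => (ellf k k' lam n : ℝ) := by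
    rw [isLittleO_iff]
    intro c hc
    filter_upwards [C3 hlam hk'le hkTop hk'Top hAL hc] with n h
    rw [Real.norm_of_nonneg (by positivity), Real.norm_of_nonneg (by positivity)]
    exact h
  have hΘ : (fun n => (((ellf k k' lam n + 1) / 2 : ℕ) : ℝ) - ((ellf k k' lam n / 3 : ℕ) : ℝ)) =Θ[atTop]
      fun n => (ellf k k' lam n : ℝ) := by
    have hb : ∀ m : ℕ, (m : ℝ) / 6 ≤ (((m + 1) / 2 : ℕ) : ℝ) - ((m / 3 : ℕ) : ℝ) ∧
        (((m + 1) / 2 : ℕ) : ℝ) - ((m / 3 : ℕ) : ℝ) ≤ m := by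
      intro m
      have a1 : m ≤ 2 * ((m + 1) / 2) := by omega
      have a2 : 3 * (m / 3) ≤ m := by omega
      have a3 : (m + 1) / 2 ≤ m := by omega
      have b1 : (m : ℝ) ≤ 2 * (((m + 1) / 2 : ℕ) : ℝ) := by exact_mod_cast a1
      have b2 : 3 * ((m / 3 : ℕ) : ℝ) ≤ m := by exact_mod_cast a2
      have b3 : (((m + 1) / 2 : ℕ) : ℝ) ≤ m := by exact_mod_cast a3
      have b4 : (0 : ℝ) ≤ ((m / 3 : ℕ) : ℝ) := by positivity
      constructor <;> linarith
    constructor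
    · refine IsBigO.of_bound 1 (Eventually.of_forall fun n => ?_)
      obtain ⟨u, v⟩ := hb (ellf k k' lam n)
      have : (0 : ℝ) ≤ ellf k k' lam n := by positivity
      rw [Real.norm_of_nonneg (by linarith), Real.norm_of_nonneg this]
      linarith
    · refine IsBigO.of_bound 6 (Eventually.of_forall fun n => ?_)
      obtain ⟨u, v⟩ := hb (ellf k k' lam n)
      have : (0 : ℝ) ≤ ellf k k' lam n := by positivity
      rw [Real.norm_of_nonneg this, Real.norm_of_nonneg (by linarith)]
      linarith
  refine ⟨400, by norm_num, 1, one_pos, ellf k k' lam, ?_, ?_, ?_, hsq, ?_,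
    fun n => ellf k k' lam n / 3, fun n => (ellf k k' lam n + 1) / 2, hΘ,
    hsq.trans_isBigO hΘ.2, ?_⟩
  · rw [isLittleO_iff]
    intro c hc
    filter_upwards [C1' hlam hk'le hkTop hk'Top hAL hc] with n h
    rw [Real.norm_of_nonneg (by positivity), Real.norm_of_nonneg (by positivity)]
    exact h
  · rw [isLittleO_iff]
    intro c hc
    filter_upwards [C2 hlam hk'le hkTop hk'Top hko hAL hAK hc] with n ⟨h1, h2⟩
    rw [Real.norm_of_nonneg (by positivity), Real.norm_of_nonneg (by positivity)]
    rcases min_choice (k n : ℝ) (k' n : ℝ) with h | h <;> rw [h] <;> assumption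
  · refine IsBigO.of_bound 1 ?_
    filter_upwards [C5 hlam hk'le hkTop hk'Top hk'o hAL] with n h
    have := hlam n
    rw [Real.norm_of_nonneg (by positivity), Real.norm_of_nonneg (by positivity)]
    exact h
  · apply whp hlam x hx hk'le hkTop hk'Top hko hk'o hAL hAK
    filter_upwards [ev_cond hlam hk'le hkTop hk'Top hko hk'o hAL hAK, basics hk'le hk'Top]
      with n ⟨hk, hℓ, hℓk, hℓK, hkK, hm0, h1, h2, hD, hD2⟩ ⟨hn, hK, hL, hτ, hτ2⟩ g hg
    exact Good_gap hτ hk (hk'le n) (hlam n) (hx n) hℓ hℓk hℓK hkK h1 h2 hD2 hg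
  · apply whp hlam x hx hk'le hkTop hk'Top hko hk'o hAL hAK
    filter_upwards [ev_cond hlam hk'le hkTop hk'Top hko hk'o hAL hAK, basics hk'le hk'Top]
      with n ⟨hk, hℓ, hℓk, hℓK, hkK, hm0, h1, h2, hD, hD2⟩ ⟨hn, hK, hL, hτ, hτ2⟩ g hg
    exact gap_ogp hℓ hℓk hℓK (by omega) hkK (hx n) hD
      (Good_gap hτ hk (hk'le n) (hlam n) (hx n) hℓ hℓk hℓK hkK h1 h2 hD2 hg)
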